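/- Let Ω ⊆ ℂⁿ be a bounded B-regular domain and let φ be a lower bounded, tame, plurisuperharmonic function on Ω with φ* = φ_* on the closure of Ω. Then the Perron–Bremermann envelope Pφ(z) = sup{u(z) : u plurisubharmonic on Ω, u* ≤ φ_* on cl(Ω)} is continuous on Ω outside a pluripolar set; more precisely, Pφ coincides outside a pluripolar set with the supremum of the subfamily of functions that are plurisubharmonic on Ω and continuous on cl(Ω). -/

import Mathlib

open Complex Polynomial Filter Set Topology

noncomputable section

/-- `u` is plurisubharmonic on `Ω ⊆ ℂⁿ`: it is upper semicontinuous on `Ω`, takes values in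
`[-∞, ∞)`, is not identically `-∞`, and on every closed disc of every complex line contained
in `Ω` it satisfies the maximum principle against real parts of complex polynomials
(an equivalent formulation of subharmonicity of the restriction to every complex line). -/
def IsPSH {n : ℕ} (Ω : Set (Fin n → ℂ)) (u : (Fin n → ℂ) → EReal) : Prop :=
  UpperSemicontinuousOn u Ω ∧
  (∀ z ∈ Ω, u z ≠ ⊤) ∧
  (∃ z ∈ Ω, u z ≠ ⊥) ∧
  ∀ z ∈ Ω, ∀ w : Fin n → ℂ, ∀ r : ℝ, 0 < r →
    (∀ ζ : ℂ, ‖ζ‖ ≤ r → z + ζ • w ∈ Ω) →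
    ∀ p : Polynomial ℂ,
      (∀ ζ : ℂ, ‖ζ‖ = r → u (z + ζ • w) ≤ (((p.eval ζ).re : ℝ) : EReal)) →
      ∀ ζ : ℂ, ‖ζ‖ ≤ r → u (z + ζ • w) ≤ (((p.eval ζ).re : ℝ) : EReal)

/-- `v` is plurisuperharmonic on `Ω` iff `-v` is plurisubharmonic on `Ω`. -/
def IsPSupH {n : ℕ} (Ω : Set (Fin n → ℂ)) (v : (Fin n → ℂ) → EReal) : Prop :=
  IsPSH Ω (fun z => -(v z))

/-- `f` belongs to the class `ℳ`: `f : Ω → [0, +∞]` admits a plurisuperharmonic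
majorant on `Ω`. -/
def MemM {n : ℕ} (Ω : Set (Fin n → ℂ)) (f : (Fin n → ℂ) → EReal) : Prop :=
  (∀ z ∈ Ω, 0 ≤ f z) ∧ ∃ v, IsPSupH Ω v ∧ ∀ z ∈ Ω, f z ≤ v z

/-- The reduced function `R_λ f`: the pointwise infimum of all plurisuperharmonic
majorants of `(f - λ)⁺ = max {f - λ, 0}` on `Ω`. -/
def Rop {n : ℕ} (Ω : Set (Fin n → ℂ)) (f : (Fin n → ℂ) → EReal) (lam : ℝ)
    (z : Fin n → ℂ) : EReal :=
  sInf { y | ∃ v, IsPSupH Ω v ∧ (∀ ζ ∈ Ω, max (f ζ - (lam : EReal)) 0 ≤ v ζ) ∧ y = v z }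

/-- Lower semicontinuous regularization of `g` relative to the set `A`:
`g_*(z) = liminf_{A ∋ ζ → z} g(ζ)`. -/
def lscReg {n : ℕ} (A : Set (Fin n → ℂ)) (g : (Fin n → ℂ) → EReal)
    (z : Fin n → ℂ) : EReal :=
  liminf g (nhdsWithin z A)

/-- Upper semicontinuous regularization of `g` relative to the set `A`:
`g*(z) = limsup_{A ∋ ζ → z} g(ζ)`. -/
def uscReg {n : ℕ} (A : Set (Fin n → ℂ)) (g : (Fin n → ℂ) → EReal)
    (z : Fin n → ℂ) : EReal :=
  limsup g (nhdsWithin z A)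

/-- `S_λ f`: the lower semicontinuous regularization of `R_λ f` on `Ω`. -/
def Slam {n : ℕ} (Ω : Set (Fin n → ℂ)) (f : (Fin n → ℂ) → EReal) (lam : ℝ) :
    (Fin n → ℂ) → EReal :=
  lscReg Ω (Rop Ω f lam)

/-- The operator `S`: the lower semicontinuous regularization of
`lim_{λ → ∞} S_λ f`; since `λ ↦ S_λ f` is decreasing on `λ ≥ 0`, this limit is the
infimum over `λ ≥ 0`. -/
def Sop {n : ℕ} (Ω : Set (Fin n → ℂ)) (f : (Fin n → ℂ) → EReal) :
    (Fin n → ℂ) → EReal :=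
  lscReg Ω (fun z => ⨅ (lam : ℝ) (_ : 0 ≤ lam), Slam Ω f lam z)

/-- `f` is tame on `Ω` if `S f ≡ 0`. -/
def Tame {n : ℕ} (Ω : Set (Fin n → ℂ)) (f : (Fin n → ℂ) → EReal) : Prop :=
  ∀ z ∈ Ω, Sop Ω f z = 0

/-- `E` is a pluripolar subset of `Ω`: `E ⊆ {w = -∞}` for some plurisubharmonic `w` on `Ω`. -/
def Pluripolar {n : ℕ} (Ω : Set (Fin n → ℂ)) (E : Set (Fin n → ℂ)) : Prop :=
  E ⊆ Ω ∧ ∃ w, IsPSH Ω w ∧ ∀ z ∈ E, w z = ⊥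

/-- `Ω` is B-regular: every continuous real-valued function on `∂Ω` is the boundary value
of a function plurisubharmonic on `Ω` and continuous on `cl(Ω)`. -/
def BRegular {n : ℕ} (Ω : Set (Fin n → ℂ)) : Prop :=
  ∀ f : (Fin n → ℂ) → ℝ, ContinuousOn f (frontier Ω) →
    ∃ u : (Fin n → ℂ) → ℝ, IsPSH Ω (fun z => ((u z : ℝ) : EReal)) ∧
      ContinuousOn u (closure Ω) ∧ ∀ z ∈ frontier Ω, u z = f z

/-- A plurisubharmonic `u` on `Ω` is maximal: for every open `Ω'` compactly contained in
`Ω` and every plurisubharmonic `v` on `Ω` with `v ≤ u` on `Ω ∖ Ω'`, one has `v ≤ u` on `Ω`. -/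
def MaximalPSH {n : ℕ} (Ω : Set (Fin n → ℂ)) (u : (Fin n → ℂ) → EReal) : Prop :=
  IsPSH Ω u ∧
  ∀ Ω' : Set (Fin n → ℂ), IsOpen Ω' → Bornology.IsBounded Ω' → closure Ω' ⊆ Ω →
    ∀ v, IsPSH Ω v → (∀ z ∈ Ω \ Ω', v z ≤ u z) → ∀ z ∈ Ω, v z ≤ u z

/-- The Perron–Bremermann envelope of the boundary data `φ`:
`Pφ(z) = sup { u(z) : u plurisubharmonic on Ω, u* ≤ φ_* on cl(Ω) }`. -/
def Perron {n : ℕ} (Ω : Set (Fin n → ℂ)) (φ : (Fin n → ℂ) → EReal)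
    (z : Fin n → ℂ) : EReal :=
  sSup { y | ∃ u, IsPSH Ω u ∧ (∀ ξ ∈ closure Ω, uscReg Ω u ξ ≤ lscReg Ω φ ξ) ∧ y = u z }

/-- Subharmonicity along discs, allowing the function `-∞`. -/
def SubH {n : ℕ} (Ω : Set (Fin n → ℂ)) (u : (Fin n → ℂ) → EReal) : Prop :=
  UpperSemicontinuousOn u Ω ∧
  (∀ z ∈ Ω, u z ≠ ⊤) ∧
  ∀ z ∈ Ω, ∀ w : Fin n → ℂ, ∀ r : ℝ, 0 < r →
    (∀ ζ : ℂ, ‖ζ‖ ≤ r → z + ζ • w ∈ Ω) →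
    ∀ p : Polynomial ℂ,
      (∀ ζ : ℂ, ‖ζ‖ = r → u (z + ζ • w) ≤ (((p.eval ζ).re : ℝ) : EReal)) →
      ∀ ζ : ℂ, ‖ζ‖ ≤ r → u (z + ζ • w) ≤ (((p.eval ζ).re : ℝ) : EReal)

theorem isPSH_iff {n : ℕ} {Ω : Set (Fin n → ℂ)} {u : (Fin n → ℂ) → EReal} :
    IsPSH Ω u ↔ SubH Ω u ∧ ∃ z ∈ Ω, u z ≠ ⊥ :=
  ⟨fun ⟨h1, h2, h3, h4⟩ => ⟨⟨h1, h2, h4⟩, h3⟩, fun ⟨⟨h1, h2, h4⟩, h3⟩ => ⟨h1, h2, h3, h4⟩⟩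

theorem IsPSH.subH {n : ℕ} {Ω : Set (Fin n → ℂ)} {u : (Fin n → ℂ) → EReal}
    (h : IsPSH Ω u) : SubH Ω u := (isPSH_iff.1 h).1

theorem EReal.le_of_forall_pos_le_add_coe {a b : EReal}
    (h : ∀ ε : ℝ, 0 < ε → a ≤ b + (ε : EReal)) : a ≤ b := by
  induction b with
  | top => exact le_top
  | bot => simpa using h 1 one_pos
  | coe b =>
    induction a with
    | top => exact absurd (h 1 one_pos) (not_le_of_gt (EReal.coe_lt_top (b + 1)))
    | bot => exact bot_le
    | coe a =>
      refine EReal.coe_le_coe_iff.2 (le_of_forall_pos_le_add fun ε hε => ?_)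
      exact_mod_cast h ε hε

theorem UpperSemicontinuousOn.add_real_continuousOn {X : Type*} [TopologicalSpace X]
    {s : Set X} {g : X → EReal} {f : X → ℝ} (hg : UpperSemicontinuousOn g s)
    (hf : ContinuousOn f s) : UpperSemicontinuousOn (fun x => g x + (f x : EReal)) s := by
  refine UpperSemicontinuousOn.add' hg
    (continuous_coe_real_ereal.comp_continuousOn hf).upperSemicontinuousOn fun x _ => ?_
  exact EReal.continuousAt_add (Or.inr (by simp)) (Or.inr (by simp))

theorem le_re_eval_of_local {g : ℂ → EReal} {r : ℝ}
    (hg : UpperSemicontinuousOn g (Metric.closedBall 0 r))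
    (htop : ∀ ζ ∈ Metric.closedBall (0 : ℂ) r, g ζ ≠ ⊤)
    (hloc : ∀ ξ : ℂ, ‖ξ‖ < r → ∃ s₀ > 0, ∀ s : ℝ, 0 < s → s < s₀ → ∀ q : ℂ[X],
      (∀ ζ : ℂ, ‖ζ‖ = s → g (ξ + ζ) ≤ ((q.eval ζ).re : ℝ)) → g ξ ≤ ((q.eval 0).re : ℝ))
    {p : ℂ[X]} (hp : ∀ ζ : ℂ, ‖ζ‖ = r → g ζ ≤ ((p.eval ζ).re : ℝ))
    {ζ : ℂ} (hζ : ‖ζ‖ ≤ r) : g ζ ≤ ((p.eval ζ).re : ℝ) := by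
  have main : ∀ ε : ℝ, 0 < ε → ∀ ζ : ℂ, ‖ζ‖ ≤ r →
      g ζ + ((-(p.eval ζ).re + ε * ‖ζ‖ ^ 2 : ℝ) : EReal) ≤ ((ε * r ^ 2 : ℝ) : EReal) := by
    intro ε hε ζ hζ
    have hcont : Continuous fun ζ : ℂ => (-(p.eval ζ).re + ε * ‖ζ‖ ^ 2 : ℝ) := by fun_prop
    obtain ⟨ξ, hξ, hmax⟩ := UpperSemicontinuousOn.exists_isMaxOn
      ⟨ζ, by simpa using hζ⟩ (isCompact_closedBall (0 : ℂ) r)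
      (hg.add_real_continuousOn hcont.continuousOn)
    refine (hmax (a := ζ) (by simpa using hζ)).trans ?_
    have hξtop := htop ξ hξ
    have hξ' : ‖ξ‖ ≤ r := by simpa using hξ
    rcases hξ'.eq_or_lt with h | h
    · calc g ξ + ((-(p.eval ξ).re + ε * ‖ξ‖ ^ 2 : ℝ) : EReal)
          ≤ ((p.eval ξ).re : ℝ) + ((-(p.eval ξ).re + ε * ‖ξ‖ ^ 2 : ℝ) : EReal) := by
            gcongr; exact hp ξ h
        _ = ((ε * r ^ 2 : ℝ) : EReal) := by
            rw [← EReal.coe_add, h]; congr 1; ring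
    · by_cases hbot : g ξ = ⊥
      · simp [hbot]
      exfalso
      lift g ξ to ℝ using ⟨hξtop, hbot⟩ with m hm
      obtain ⟨s₀, hs₀, H⟩ := hloc ξ h
      obtain ⟨s, hs, hs'⟩ := exists_between (lt_min hs₀ (sub_pos.2 h))
      have hsr : s < r - ‖ξ‖ := hs'.trans_le (min_le_right _ _)
      set M : ℝ := m + (-(p.eval ξ).re + ε * ‖ξ‖ ^ 2) with hM
      let q : ℂ[X] := p.comp (X + C ξ) + C ((M - ε * (‖ξ‖ ^ 2 + s ^ 2) : ℝ) : ℂ)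
        + C (-(2 * ε : ℝ) * (starRingEnd ℂ) ξ) * X
      have hq : ∀ ζ : ℂ, (q.eval ζ).re = (p.eval (ξ + ζ)).re + (M - ε * (‖ξ‖ ^ 2 + s ^ 2))
          - 2 * ε * (ξ.re * ζ.re + ξ.im * ζ.im) := by
        intro ζ
        simp only [q, Polynomial.eval_add, Polynomial.eval_comp, Polynomial.eval_X,
          Polynomial.eval_C, Polynomial.eval_mul, Complex.add_re, Complex.ofReal_re,
          Complex.mul_re, Complex.neg_re, Complex.neg_im, Complex.conj_re, Complex.conj_im,
          Complex.ofReal_im, Complex.mul_im, add_comm ζ ξ]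
        ring
      have hle := H s hs (hs'.trans_le (min_le_left _ _)) q fun η hη => by
        have hmem : ξ + η ∈ Metric.closedBall (0 : ℂ) r := by
          simp only [mem_closedBall_zero_iff]
          linarith [norm_add_le ξ η]
        have h1 := hmax hmem
        simp only [Set.mem_ofPred_eq, ← hm] at h1
        rw [← EReal.coe_add, ← hM] at h1
        have hnorm : ‖ξ + η‖ ^ 2 = ‖ξ‖ ^ 2 + s ^ 2 + 2 * (ξ.re * η.re + ξ.im * η.im) := by
          rw [← hη, Complex.sq_norm, Complex.sq_norm, Complex.sq_norm, Complex.normSq_apply,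
            Complex.normSq_apply, Complex.normSq_apply]
          simp; ring
        have hηtop := htop _ hmem
        generalize g (ξ + η) = y at *
        induction y with
        | top => exact absurd rfl hηtop
        | bot => exact bot_le
        | coe y =>
          rw [← EReal.coe_add] at h1
          rw [hq, EReal.coe_le_coe_iff]
          have := EReal.coe_le_coe_iff.1 h1
          rw [hnorm] at this
          linarith
      rw [← hm, EReal.coe_le_coe_iff, hq] at hle
      simp only [Complex.zero_re, Complex.zero_im, add_zero, mul_zero] at hle
      nlinarith [mul_pos hε (pow_pos hs 2)]
  have hζtop := htop ζ (by simpa using hζ)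
  have h2 := fun ε hε => main ε hε ζ hζ
  generalize g ζ = y at *
  induction y with
  | top => exact absurd rfl hζtop
  | bot => exact bot_le
  | coe y =>
    have key : ∀ ε : ℝ, 0 < ε → y ≤ (p.eval ζ).re + ε * r ^ 2 := by
      intro ε hε
      have := h2 ε hε
      rw [← EReal.coe_add, EReal.coe_le_coe_iff] at this
      nlinarith [mul_nonneg hε.le (sq_nonneg ‖ζ‖)]
    rw [EReal.coe_le_coe_iff]
    refine le_of_forall_pos_le_add fun ε hε => ?_
    have h3 := key (ε / (r ^ 2 + 1)) (by positivity)
    have h4 : ε / (r ^ 2 + 1) * r ^ 2 ≤ ε := by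
      rw [div_mul_eq_mul_div, div_le_iff₀ (by positivity)]; nlinarith
    linarith

theorem SubH.of_local {n : ℕ} {Ω : Set (Fin n → ℂ)} {u : (Fin n → ℂ) → EReal}
    (hu : UpperSemicontinuousOn u Ω) (htop : ∀ z ∈ Ω, u z ≠ ⊤)
    (hloc : ∀ z ∈ Ω, ∀ w : Fin n → ℂ, ∃ s₀ > 0, ∀ s : ℝ, 0 < s → s < s₀ → ∀ p : ℂ[X],
      (∀ ζ : ℂ, ‖ζ‖ = s → u (z + ζ • w) ≤ ((p.eval ζ).re : ℝ)) → u z ≤ ((p.eval 0).re : ℝ)) :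
    SubH Ω u := by
  refine ⟨hu, htop, fun z _ w r hr hD p hp ζ hζ => ?_⟩
  refine le_re_eval_of_local (g := fun ζ => u (z + ζ • w)) (r := r) ?_ ?_ ?_ hp hζ
  · refine UpperSemicontinuousOn.comp hu (Continuous.continuousOn (by fun_prop)) ?_
    intro η hη
    exact hD η (by simpa using hη)
  · intro η hη
    exact htop _ (hD η (by simpa using hη))
  · intro ξ hξ
    obtain ⟨s₀, hs₀, H⟩ := hloc (z + ξ • w) (hD ξ hξ.le) w
    refine ⟨s₀, hs₀, fun s hs hs' q hq => H s hs hs' q fun η hη => ?_⟩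
    have := hq η hη
    rwa [add_smul, ← add_assoc] at this

/-- Small discs around a point of an open set stay in it. -/
theorem IsOpen.exists_disc_subset {n : ℕ} {Ω : Set (Fin n → ℂ)} (hΩ : IsOpen Ω)
    {z : Fin n → ℂ} (hz : z ∈ Ω) (w : Fin n → ℂ) :
    ∃ s₀ > 0, ∀ s : ℝ, s < s₀ → ∀ ζ : ℂ, ‖ζ‖ ≤ s → z + ζ • w ∈ Ω := by
  have hc : ContinuousAt (fun ζ : ℂ => z + ζ • w) 0 := by fun_prop
  have := hc.preimage_mem_nhds (hΩ.mem_nhds (by simpa using hz))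
  obtain ⟨s₀, hs₀, H⟩ := Metric.mem_nhds_iff.1 this
  exact ⟨s₀, hs₀, fun s hs ζ hζ => H (by simpa using hζ.trans_lt hs)⟩

theorem SubH.center {n : ℕ} {Ω : Set (Fin n → ℂ)} {u : (Fin n → ℂ) → EReal} (hu : SubH Ω u)
    {z : Fin n → ℂ} (hz : z ∈ Ω) {w : Fin n → ℂ} {r : ℝ} (hr : 0 < r)
    (hD : ∀ ζ : ℂ, ‖ζ‖ ≤ r → z + ζ • w ∈ Ω) {p : ℂ[X]}
    (hp : ∀ ζ : ℂ, ‖ζ‖ = r → u (z + ζ • w) ≤ ((p.eval ζ).re : ℝ)) :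
    u z ≤ ((p.eval 0).re : ℝ) := by
  simpa using hu.2.2 z hz w r hr hD p hp 0 (by simpa using hr.le)

theorem SubH.congr {n : ℕ} {Ω : Set (Fin n → ℂ)} {u v : (Fin n → ℂ) → EReal} (hu : SubH Ω u)
    (h : ∀ z ∈ Ω, u z = v z) : SubH Ω v := by
  refine ⟨fun z hz => ?_, fun z hz => h z hz ▸ hu.2.1 z hz, fun z hz w r hr hD p hp ζ hζ => ?_⟩
  · intro y hy
    simp only [← h z hz] at hy
    filter_upwards [hu.1 z hz y hy, self_mem_nhdsWithin] with x hx hx'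
    rwa [← h x hx']
  · rw [← h _ (hD ζ hζ)]
    exact hu.2.2 z hz w r hr hD p (fun ζ hζ => by rw [h _ (hD ζ hζ.le)]; exact hp ζ hζ) ζ hζ

theorem SubH.sup {n : ℕ} {Ω : Set (Fin n → ℂ)} {u v : (Fin n → ℂ) → EReal} (hu : SubH Ω u)
    (hv : SubH Ω v) : SubH Ω fun z => max (u z) (v z) := by
  refine ⟨hu.1.sup hv.1, fun z hz => ?_, fun z hz w r hr hD p hp ζ hζ => ?_⟩
  · dsimp only
    rcases max_choice (u z) (v z) with h | h <;> rw [h]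
    exacts [hu.2.1 z hz, hv.2.1 z hz]
  · exact max_le
      (hu.2.2 z hz w r hr hD p (fun ζ hζ => (le_max_left _ _).trans (hp ζ hζ)) ζ hζ)
      (hv.2.2 z hz w r hr hD p (fun ζ hζ => (le_max_right _ _).trans (hp ζ hζ)) ζ hζ)

section CircleAverages

open MeasureTheory AddCircle

/-- The standard parametrization of the unit circle by `ℝ / ℤ`. -/
def circPt (t : UnitAddCircle) : ℂ := (AddCircle.toCircle t : ℂ)

theorem continuous_circPt : Continuous circPt :=
  continuous_subtype_val.comp AddCircle.continuous_toCircle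

@[simp] theorem norm_circPt (t : UnitAddCircle) : ‖circPt t‖ = 1 := Circle.norm_coe _

theorem fourier_eq_circPt_pow (k : ℕ) (t : UnitAddCircle) :
    fourier (k : ℤ) t = circPt t ^ k := by
  simp [fourier_apply, circPt, AddCircle.toCircle_nsmul]

theorem exists_circPt {s : ℝ} (hs : 0 < s) {ζ : ℂ} (hζ : ‖ζ‖ = s) :
    ∃ t, ζ = (s : ℂ) * circPt t := by
  have hne : (s : ℂ) ≠ 0 := by exact_mod_cast hs.ne'
  have h1 : ‖ζ / s‖ = 1 := by
    rw [norm_div, hζ, Complex.norm_real, Real.norm_of_nonneg hs.le, div_self hs.ne']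
  obtain ⟨t, ht⟩ := (AddCircle.homeomorphCircle (T := 1) one_ne_zero).surjective
    ⟨ζ / s, mem_sphere_zero_iff_norm.2 h1⟩
  refine ⟨t, ?_⟩
  rw [AddCircle.homeomorphCircle_apply] at ht
  rw [circPt, ht]
  field_simp

theorem norm_mul_circPt {s : ℝ} (hs : 0 ≤ s) (t : UnitAddCircle) :
    ‖(s : ℂ) * circPt t‖ = s := by
  simp [abs_of_nonneg hs]

theorem continuous_eval_circPt (p : ℂ[X]) (s : ℝ) :
    Continuous fun t : UnitAddCircle => (p.eval ((s : ℂ) * circPt t)).re := by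
  have := continuous_circPt
  fun_prop

theorem integral_circPt_pow {k : ℕ} (hk : k ≠ 0) :
    ∫ t : UnitAddCircle, circPt t ^ k ∂haarAddCircle = 0 := by
  simp_rw [← fourier_eq_circPt_pow]
  exact integral_eq_zero_of_add_right_eq_neg (μ := haarAddCircle)
    (fourier_add_half_inv_index (T := 1) (n := k) (by exact_mod_cast hk) one_pos)

theorem integral_eval_circPt (p : ℂ[X]) (s : ℝ) :
    ∫ t : UnitAddCircle, (p.eval ((s : ℂ) * circPt t)).re ∂haarAddCircle = (p.eval 0).re := by
  have hc := continuous_circPt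
  have key : ∫ t : UnitAddCircle, p.eval ((s : ℂ) * circPt t) ∂haarAddCircle = p.eval 0 := by
    induction p using Polynomial.induction_on' with
    | add p q hp hq =>
      simp only [eval_add]
      rw [integral_add, hp, hq]
      · exact Continuous.integrable_of_hasCompactSupport (by fun_prop)
          (HasCompactSupport.of_compactSpace _)
      · exact Continuous.integrable_of_hasCompactSupport (by fun_prop)
          (HasCompactSupport.of_compactSpace _)
    | monomial k a =>
      rcases eq_or_ne k 0 with rfl | hk
      · simp
      · simp only [eval_monomial, mul_pow, ← mul_assoc]
        rw [integral_const_mul, integral_circPt_pow hk]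
        simp [hk]
  rw [← key]
  exact integral_re (f := fun t : UnitAddCircle => p.eval ((s : ℂ) * circPt t))
    (Continuous.integrable_of_hasCompactSupport (by fun_prop)
      (HasCompactSupport.of_compactSpace _))

/-- Real trigonometric polynomials are dense among the continuous functions on the circle, and
are real parts of holomorphic polynomials. -/
theorem exists_polynomial_re_near {s : ℝ} (hs : 0 < s) (f : C(UnitAddCircle, ℝ)) {ε : ℝ}
    (hε : 0 < ε) :
    ∃ p : ℂ[X], ∀ t, |(p.eval ((s : ℂ) * circPt t)).re - f t| < ε := by
  have hs' : (s : ℂ) ≠ 0 := by exact_mod_cast hs.ne'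
  have hspan : ∀ g ∈ Submodule.span ℂ (range (@fourier 1)), ∀ c : ℂ,
      ∃ p : ℂ[X], ∀ t, (p.eval ((s : ℂ) * circPt t)).re = (c * g t).re := by
    intro g hg
    induction hg using Submodule.span_induction with
    | mem g hg =>
      obtain ⟨k, rfl⟩ := hg
      intro c
      obtain ⟨m, rfl | rfl⟩ := k.eq_nat_or_neg
      · refine ⟨C (c / s ^ m) * X ^ m, fun t => ?_⟩
        rw [fourier_eq_circPt_pow]
        simp only [eval_mul, eval_C, eval_pow, eval_X]
        congr 1
        field_simp
        ring
      · refine ⟨C ((starRingEnd ℂ) c / s ^ m) * X ^ m, fun t => ?_⟩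
        rw [fourier_neg, fourier_eq_circPt_pow, ← Complex.conj_re]
        simp only [eval_mul, eval_C, eval_pow, eval_X, map_mul, map_div₀, map_pow,
          Complex.conj_conj, Complex.conj_ofReal]
        congr 1
        field_simp
        ring
    | zero => exact fun c => ⟨0, by simp⟩
    | add g h _ _ ihg ihh =>
      intro c
      obtain ⟨p, hp⟩ := ihg c
      obtain ⟨q, hq⟩ := ihh c
      exact ⟨p + q, fun t => by simp [hp, hq, mul_add]⟩
    | smul a g _ ih =>
      intro c
      obtain ⟨p, hp⟩ := ih (c * a)
      exact ⟨p, fun t => by simp [hp, mul_assoc]⟩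
  let F : C(UnitAddCircle, ℂ) := ⟨fun t => (f t : ℂ), by fun_prop⟩
  have hF : F ∈ closure (Submodule.span ℂ (range (@fourier 1)) : Set C(UnitAddCircle, ℂ)) := by
    rw [← Submodule.topologicalClosure_coe, span_fourier_closure_eq_top]
    trivial
  obtain ⟨g, hg, hgF⟩ := Metric.mem_closure_iff.1 hF ε hε
  obtain ⟨p, hp⟩ := hspan g hg 1
  refine ⟨p, fun t => ?_⟩
  rw [hp, one_mul]
  calc |(g t).re - f t| = |(g t - F t).re| := by simp [F]
    _ ≤ ‖g t - F t‖ := Complex.abs_re_le_norm _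
    _ = dist (F t) (g t) := by rw [dist_comm, dist_eq_norm]
    _ ≤ dist F g := ContinuousMap.dist_apply_le_dist t
    _ < ε := hgF

/-- Strict insertion of a continuous function between semicontinuous functions. -/
theorem exists_continuous_between {X : Type*} [TopologicalSpace X] [NormalSpace X]
    [ParacompactSpace X] {a c : X → EReal} (ha : UpperSemicontinuous a)
    (hc : LowerSemicontinuous c) (h : ∀ x, a x < c x) :
    ∃ f : C(X, ℝ), ∀ x, a x < f x ∧ (f x : EReal) < c x := by
  have := exists_continuous_forall_mem_convex_of_local_const (X := X) (E := ℝ)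
    (t := fun x => {r : ℝ | a x < r ∧ (r : EReal) < c x}) ?_ ?_
  · exact this
  · intro x
    refine Set.OrdConnected.convex ⟨fun r hr r' hr' y hy => ⟨hr.1.trans_le ?_, ?_⟩⟩
    · exact_mod_cast hy.1
    · exact lt_of_le_of_lt (by exact_mod_cast hy.2) hr'.2
  · intro x
    obtain ⟨r, hr1, hr2⟩ := EReal.lt_iff_exists_real_btwn.1 (h x)
    exact ⟨r, (ha x r hr1).and (hc x r hr2)⟩

theorem SubH.usc_circle {n : ℕ} {Ω : Set (Fin n → ℂ)} {u : (Fin n → ℂ) → EReal}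
    (hu : UpperSemicontinuousOn u Ω) {z w : Fin n → ℂ} {s : ℝ} (hs : 0 ≤ s)
    (hD : ∀ ζ : ℂ, ‖ζ‖ ≤ s → z + ζ • w ∈ Ω) :
    UpperSemicontinuous fun t : UnitAddCircle => u (z + ((s : ℂ) * circPt t) • w) := by
  have hc := continuous_circPt
  rw [← upperSemicontinuousOn_univ_iff]
  refine UpperSemicontinuousOn.comp hu (Continuous.continuousOn (by fun_prop)) ?_
  intro t _
  exact hD _ (norm_mul_circPt hs t).le

theorem subH_const {n : ℕ} (Ω : Set (Fin n → ℂ)) (c : ℝ) :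
    SubH Ω fun _ => (c : EReal) := by
  refine SubH.of_local continuousOn_const.upperSemicontinuousOn (by simp) fun z _ w =>
    ⟨1, one_pos, fun s hs _ p hp => ?_⟩
  rw [EReal.coe_le_coe_iff, ← integral_eval_circPt p s]
  have : ∫ _ : UnitAddCircle, c ∂haarAddCircle = c := by simp
  rw [← this]
  refine integral_mono (integrable_const _) ?_ fun t => ?_
  · exact (continuous_eval_circPt p s).integrable_of_hasCompactSupport
      (HasCompactSupport.of_compactSpace _)
  · exact_mod_cast hp _ (norm_mul_circPt hs.le t)

theorem SubH.add {n : ℕ} {Ω : Set (Fin n → ℂ)} (hΩ : IsOpen Ω) {u v : (Fin n → ℂ) → EReal}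
    (hu : SubH Ω u) (hv : SubH Ω v) : SubH Ω fun z => u z + v z := by
  refine SubH.of_local (UpperSemicontinuousOn.add' hu.1 hv.1 fun z hz =>
    EReal.continuousAt_add (Or.inl (hu.2.1 z hz)) (Or.inr (hv.2.1 z hz)))
    (fun z hz => EReal.add_ne_top (hu.2.1 z hz) (hv.2.1 z hz)) fun z hz w => ?_
  obtain ⟨s₀, hs₀, hD⟩ := hΩ.exists_disc_subset hz w
  refine ⟨s₀, hs₀, fun s hs hs' p hp => ?_⟩
  have hD := hD s hs'
  have hmem := fun t => hD _ (norm_mul_circPt hs.le t).le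
  have main : ∀ ε : ℝ, 0 < ε → u z + v z ≤ (((p.eval 0).re + 3 * ε : ℝ) : EReal) := by
    intro ε hε
    have hins : ∃ f : C(UnitAddCircle, ℝ), ∀ t, u (z + ((s : ℂ) * circPt t) • w) < f t ∧
        (f t : EReal) < -(v (z + ((s : ℂ) * circPt t) • w) +
          ((-((p.eval ((s : ℂ) * circPt t)).re + ε) : ℝ) : EReal)) := by
      refine exists_continuous_between (SubH.usc_circle hu.1 hs.le hD) ?_ ?_
      · refine continuous_neg.comp_upperSemicontinuous_antitone ?_ fun a b h => ?_
        · rw [← upperSemicontinuousOn_univ_iff]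
          refine UpperSemicontinuousOn.add_real_continuousOn
            ((SubH.usc_circle hv.1 hs.le hD).upperSemicontinuousOn _) ?_
          exact ((continuous_eval_circPt p s).add continuous_const).neg.continuousOn
        · exact EReal.neg_le_neg_iff.2 h
      · intro t
        have h1 := hp _ (norm_mul_circPt hs.le t)
        have h2 := hu.2.1 _ (hmem t)
        have h3 := hv.2.1 _ (hmem t)
        generalize u (z + ((s : ℂ) * circPt t) • w) = x at *
        generalize v (z + ((s : ℂ) * circPt t) • w) = y at *
        induction y with
        | top => exact absurd rfl h3
        | bot => simpa using h2.lt_top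
        | coe y =>
          induction x with
          | top => exact absurd rfl h2
          | bot => rw [← EReal.coe_add, ← EReal.coe_neg]; exact EReal.bot_lt_coe _
          | coe x =>
            rw [← EReal.coe_add, EReal.coe_le_coe_iff] at h1
            rw [← EReal.coe_add, ← EReal.coe_neg, EReal.coe_lt_coe_iff]
            linarith
    obtain ⟨f, hf⟩ := hins
    obtain ⟨q, hq⟩ := exists_polynomial_re_near hs f hε
    have h1 : u z ≤ (((q + C (ε : ℂ)).eval 0).re : ℝ) := by
      refine hu.center hz hs hD fun ζ hζ => ?_
      obtain ⟨t, rfl⟩ := exists_circPt hs hζ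
      refine (hf t).1.le.trans (EReal.coe_le_coe_iff.2 ?_)
      have := abs_lt.1 (hq t)
      simp only [eval_add, eval_C, Complex.add_re, Complex.ofReal_re]
      linarith
    have h2 : v z ≤ (((p - q + C (2 * ε : ℂ)).eval 0).re : ℝ) := by
      refine hv.center hz hs hD fun ζ hζ => ?_
      obtain ⟨t, rfl⟩ := exists_circPt hs hζ
      have h3 := (hf t).2
      have h4 := hv.2.1 _ (hmem t)
      have := abs_lt.1 (hq t)
      generalize v (z + ((s : ℂ) * circPt t) • w) = y at *
      induction y with
      | top => exact absurd rfl h4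
      | bot => exact bot_le
      | coe y =>
        rw [← EReal.coe_add, ← EReal.coe_neg, EReal.coe_lt_coe_iff] at h3
        rw [EReal.coe_le_coe_iff]
        simp only [eval_add, eval_sub, eval_C, Complex.add_re, Complex.sub_re, Complex.mul_re,
          Complex.ofReal_re, Complex.ofReal_im, Complex.re_ofNat, Complex.im_ofNat]
        linarith
    refine (add_le_add h1 h2).trans (le_of_eq ?_)
    rw [← EReal.coe_add]
    congr 1
    simp only [eval_add, eval_sub, eval_C, Complex.add_re, Complex.sub_re, Complex.mul_re,
          Complex.ofReal_re, Complex.ofReal_im, Complex.re_ofNat, Complex.im_ofNat]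
    ring
  refine EReal.le_of_forall_pos_le_add_coe fun ε hε => ?_
  have := main (ε / 3) (by positivity)
  rwa [mul_div_cancel₀ _ (by norm_num : (3 : ℝ) ≠ 0), EReal.coe_add] at this

end CircleAverages

/-- Maximum principle on bounded open sets. -/
theorem SubH.nonpos_of_frontier {n : ℕ} (i : Fin n) {Ω : Set (Fin n → ℂ)} (hΩ : IsOpen Ω)
    (hΩb : Bornology.IsBounded Ω) {g : (Fin n → ℂ) → ℝ} (hgc : ContinuousOn g (closure Ω))
    (hg : SubH Ω fun z => (g z : EReal)) (hf : ∀ z ∈ frontier Ω, g z ≤ 0) :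
    ∀ z ∈ Ω, g z ≤ 0 := by
  intro z hz
  have hK : IsCompact (closure Ω) := hΩb.isCompact_closure
  obtain ⟨R, hR⟩ := hK.isBounded.exists_norm_le
  have main : ∀ ε : ℝ, 0 < ε → g z ≤ ε * R ^ 2 := by
    intro ε hε
    obtain ⟨ξ, hξ, hmax⟩ := hK.exists_isMaxOn ⟨z, subset_closure hz⟩
      (f := fun z => g z + ε * ‖z i‖ ^ 2) (hgc.add (Continuous.continuousOn (by fun_prop)))
    by_cases hξΩ : ξ ∈ Ω
    · exfalso
      obtain ⟨s₀, hs₀, hD⟩ := hΩ.exists_disc_subset hξΩ (Pi.single i 1)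
      obtain ⟨s, hs, hs'⟩ := exists_between hs₀
      have hD := hD s hs'
      set M : ℝ := g ξ + ε * ‖ξ i‖ ^ 2 with hM
      let q : ℂ[X] := C ((M - ε * (‖ξ i‖ ^ 2 + s ^ 2) : ℝ) : ℂ)
        + C (-(2 * ε : ℝ) * (starRingEnd ℂ) (ξ i)) * X
      have hq : ∀ ζ : ℂ, (q.eval ζ).re = (M - ε * (‖ξ i‖ ^ 2 + s ^ 2))
          - 2 * ε * ((ξ i).re * ζ.re + (ξ i).im * ζ.im) := by
        intro ζ
        simp only [q, Polynomial.eval_add, Polynomial.eval_X,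
          Polynomial.eval_C, Polynomial.eval_mul, Complex.add_re, Complex.ofReal_re,
          Complex.mul_re, Complex.neg_re, Complex.neg_im, Complex.conj_re, Complex.conj_im,
          Complex.ofReal_im, Complex.mul_im]
        ring
      have hle := hg.center (p := q) hξΩ hs hD fun η hη => by
        have h1 := hmax (subset_closure (hD η hη.le))
        simp only [Set.mem_ofPred_eq, ← hM, Pi.add_apply, Pi.smul_apply, Pi.single_eq_same,
          smul_eq_mul, mul_one] at h1
        have hnorm : ‖ξ i + η‖ ^ 2 = ‖ξ i‖ ^ 2 + s ^ 2
            + 2 * ((ξ i).re * η.re + (ξ i).im * η.im) := by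
          rw [← hη, Complex.sq_norm, Complex.sq_norm, Complex.sq_norm, Complex.normSq_apply,
            Complex.normSq_apply, Complex.normSq_apply]
          simp; ring
        rw [hq, EReal.coe_le_coe_iff]
        rw [hnorm] at h1
        linarith
      rw [EReal.coe_le_coe_iff, hq] at hle
      simp only [Complex.zero_re, Complex.zero_im, add_zero, mul_zero] at hle
      nlinarith [mul_pos hε (pow_pos hs 2)]
    · have h1 := hmax (subset_closure hz)
      have h2 := hf ξ ⟨hξ, by rwa [hΩ.interior_eq]⟩
      have h3 : ‖ξ i‖ ≤ R := (norm_le_pi_norm ξ i).trans (hR ξ hξ)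
      have h4 : ‖ξ i‖ ^ 2 ≤ R ^ 2 := by gcongr
      have h5 := mul_nonneg hε.le (sq_nonneg ‖z i‖)
      have h6 := mul_le_mul_of_nonneg_left h4 hε.le
      simp only [Set.mem_ofPred_eq] at h1
      linarith
  refine le_of_forall_pos_le_add fun ε hε => ?_
  have h3 := main (ε / (R ^ 2 + 1)) (by positivity)
  have h4 : ε / (R ^ 2 + 1) * R ^ 2 ≤ ε := by
    rw [div_mul_eq_mul_div, div_le_iff₀ (by positivity)]; nlinarith
  linarith

theorem le_uscReg {n : ℕ} {Ω : Set (Fin n → ℂ)} {z : Fin n → ℂ} (hz : z ∈ Ω)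
    (U : (Fin n → ℂ) → EReal) : U z ≤ uscReg Ω U z := by
  refine le_limsup_of_frequently_le ?_
  rw [frequently_iff]
  intro s hs
  exact ⟨z, mem_of_mem_nhdsWithin hz hs, le_rfl⟩

theorem upperSemicontinuousOn_uscReg {n : ℕ} (Ω : Set (Fin n → ℂ)) (U : (Fin n → ℂ) → EReal)
    (A : Set (Fin n → ℂ)) (hA : A ⊆ Ω) : UpperSemicontinuousOn (uscReg Ω U) A := by
  intro z _ y hy
  obtain ⟨y', h1, h2⟩ := exists_between hy
  have h3 : ∀ᶠ x in 𝓝[Ω] z, U x < y' := eventually_lt_of_limsup_lt h1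
  filter_upwards [(eventually_eventually_nhdsWithin.2 h3).filter_mono (nhdsWithin_mono z hA)]
    with x hx
  exact (limsup_le_of_le (h := hx.mono fun _ h => h.le)).trans_lt h2

theorem subH_uscReg {n : ℕ} {Ω : Set (Fin n → ℂ)} (hΩ : IsOpen Ω)
    {F : Set ((Fin n → ℂ) → EReal)} (hF : ∀ u ∈ F, SubH Ω u) {U : (Fin n → ℂ) → EReal}
    (hU : ∀ z ∈ Ω, ∀ u ∈ F, u z ≤ U z)
    (hU' : ∀ z ∈ Ω, ∀ b, (∀ u ∈ F, u z ≤ b) → U z ≤ b)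
    (htop : ∀ z ∈ Ω, uscReg Ω U z ≠ ⊤) : SubH Ω (uscReg Ω U) := by
  refine SubH.of_local (upperSemicontinuousOn_uscReg Ω U Ω subset_rfl) htop fun z hz w => ?_
  obtain ⟨s₀, hs₀, hD⟩ := hΩ.exists_disc_subset hz w
  refine ⟨s₀, hs₀, fun s hs hs' p hp => ?_⟩
  have hD := hD s hs'
  refine EReal.le_of_forall_pos_le_add_coe fun ε hε => ?_
  have hcont : Continuous fun x : (Fin n → ℂ) × ℂ => x.1 + x.2 • w := by fun_prop
  have h1 : ∀ᶠ z' in 𝓝 z, ∀ ζ ∈ Metric.closedBall (0 : ℂ) s, z' + ζ • w ∈ Ω := by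
    refine (isCompact_closedBall (0 : ℂ) s).eventually_forall_of_forall_eventually
      fun ζ hζ => ?_
    exact hcont.continuousAt.eventually (hΩ.mem_nhds (hD ζ (by simpa using hζ)))
  have h2 : ∀ᶠ z' in 𝓝 z, ∀ ζ ∈ Metric.sphere (0 : ℂ) s,
      U (z' + ζ • w) ≤ (((p.eval ζ).re + ε : ℝ) : EReal) := by
    refine (isCompact_sphere (0 : ℂ) s).eventually_forall_of_forall_eventually
      fun ζ hζ => ?_
    have hζ' : ‖ζ‖ = s := by simpa using hζ
    have h3 : uscReg Ω U (z + ζ • w) < (((p.eval ζ).re + ε : ℝ) : EReal) :=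
      (hp ζ hζ').trans_lt (EReal.coe_lt_coe_iff.2 (by linarith))
    obtain ⟨c, hc1, hc2⟩ := EReal.lt_iff_exists_real_btwn.1 h3
    have h4 : ∀ᶠ x in 𝓝[Ω] (z + ζ • w), U x < c := eventually_lt_of_limsup_lt hc1
    rw [hΩ.nhdsWithin_eq (hD ζ hζ'.le)] at h4
    have h5 : ∀ᶠ x in 𝓝 (z, ζ), U (x.1 + x.2 • w) < c :=
      (hcont.tendsto (z, ζ)).eventually (p := fun y => U y < c) h4
    have h6 : ∀ᶠ x in 𝓝 (z, ζ), c < (p.eval x.2).re + ε := by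
      have : Continuous fun x : (Fin n → ℂ) × ℂ => (p.eval x.2).re + ε := by fun_prop
      exact this.continuousAt.eventually (lt_mem_nhds (EReal.coe_lt_coe_iff.1 hc2))
    filter_upwards [h5, h6] with x hx hx'
    exact hx.le.trans (EReal.coe_le_coe_iff.2 hx'.le)
  have h3 : ∀ᶠ z' in 𝓝[Ω] z, U z' ≤ (((p.eval 0).re + ε : ℝ) : EReal) := by
    filter_upwards [self_mem_nhdsWithin, h1.filter_mono nhdsWithin_le_nhds,
      h2.filter_mono nhdsWithin_le_nhds] with z' hz' hz1 hz2
    refine hU' z' hz' _ fun u hu => ?_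
    have := (hF u hu).center (p := p + C (ε : ℂ)) hz' hs (fun ζ hζ => hz1 ζ (by simpa using hζ))
      fun ζ hζ => by
        have := (hU _ (hz1 ζ (by simp [hζ])) u hu).trans (hz2 ζ (by simpa using hζ))
        simpa using this
    simpa using this
  rw [← EReal.coe_add]
  exact limsup_le_of_le (h := h3)

theorem SubH.iInf_of_antitone {n : ℕ} {Ω : Set (Fin n → ℂ)}
    {b : ℕ → (Fin n → ℂ) → EReal} (hb : ∀ N, SubH Ω (b N))
    (hanti : ∀ z ∈ Ω, Antitone fun N => b N z) : SubH Ω fun z => ⨅ N, b N z := by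
  refine ⟨upperSemicontinuousOn_iInf fun N => (hb N).1,
    fun z hz => ne_top_of_le_ne_top ((hb 0).2.1 z hz) (iInf_le _ 0),
    fun z hz w r hr hD p hp ζ hζ => ?_⟩
  refine EReal.le_of_forall_pos_le_add_coe fun ε hε => ?_
  have key : ∃ N, ∀ η ∈ Metric.sphere (0 : ℂ) r,
      b N (z + η • w) ≤ (((p.eval η).re + ε : ℝ) : EReal) := by
    refine (isCompact_sphere (0 : ℂ) r).induction_on
      (p := fun S => ∃ N, ∀ η ∈ S, η ∈ Metric.sphere (0 : ℂ) r →
        b N (z + η • w) ≤ (((p.eval η).re + ε : ℝ) : EReal)) ?_ ?_ ?_ ?_ |>.imp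
        fun N hN η hη => hN η hη hη
    · exact ⟨0, by simp⟩
    · exact fun S T hST ⟨N, hN⟩ => ⟨N, fun η hη => hN η (hST hη)⟩
    · rintro S T ⟨N, hN⟩ ⟨M, hM⟩
      refine ⟨max N M, fun η hη hη' => ?_⟩
      have hmem := hD η (by simpa using hη'.le)
      rcases hη with hη | hη
      · exact (hanti _ hmem (le_max_left N M)).trans (hN η hη hη')
      · exact (hanti _ hmem (le_max_right N M)).trans (hM η hη hη')
    · intro η hη
      have hη' : ‖η‖ = r := by simpa using hη
      have h3 : ⨅ N, b N (z + η • w) < (((p.eval η).re + ε : ℝ) : EReal) :=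
        (hp η hη').trans_lt (EReal.coe_lt_coe_iff.2 (by linarith))
      obtain ⟨N, hN⟩ := iInf_lt_iff.1 h3
      obtain ⟨c, hc1, hc2⟩ := EReal.lt_iff_exists_real_btwn.1 hN
      have h4 : UpperSemicontinuousOn (fun η : ℂ => b N (z + η • w))
          (Metric.sphere (0 : ℂ) r) := by
        refine UpperSemicontinuousOn.comp (hb N).1 (Continuous.continuousOn (by fun_prop)) ?_
        intro η hη
        exact hD η (by simpa using hη.le)
      have h5 : ∀ᶠ x in 𝓝[Metric.sphere (0 : ℂ) r] η, c < (p.eval x).re + ε := by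
        have : Continuous fun x : ℂ => (p.eval x).re + ε := by fun_prop
        exact (this.continuousAt.eventually
          (lt_mem_nhds (EReal.coe_lt_coe_iff.1 hc2))).filter_mono nhdsWithin_le_nhds
      refine ⟨_, (h4 η hη c hc1).and h5, N, fun x hx _ => ?_⟩
      exact hx.1.le.trans (EReal.coe_le_coe_iff.2 hx.2.le)
  obtain ⟨N, hN⟩ := key
  have := (hb N).2.2 z hz w r hr hD (p + C (ε : ℂ))
    (fun η hη => by simpa using hN η (by simpa using hη)) ζ hζ
  exact (iInf_le _ N).trans (by simpa using this)

theorem SubH.mono {n : ℕ} {Ω N : Set (Fin n → ℂ)} {u : (Fin n → ℂ) → EReal} (hu : SubH Ω u)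
    (h : N ⊆ Ω) : SubH N u :=
  ⟨hu.1.mono h, fun z hz => hu.2.1 z (h hz), fun z hz w r hr hD =>
    hu.2.2 z (h hz) w r hr fun ζ hζ => h (hD ζ hζ)⟩

theorem SubH.translate {n : ℕ} {Ω : Set (Fin n → ℂ)} {u : (Fin n → ℂ) → EReal}
    (hu : SubH Ω u) (h : Fin n → ℂ) : SubH {z | z + h ∈ Ω} fun z => u (z + h) := by
  refine ⟨?_, fun z hz => hu.2.1 _ hz, fun z hz w r hr hD p hp ζ hζ => ?_⟩
  · exact UpperSemicontinuousOn.comp hu.1 (Continuous.continuousOn (by fun_prop))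
      fun z hz => hz
  · have := hu.2.2 (z + h) hz w r hr
      (fun ζ hζ => by have := hD ζ hζ; rwa [Set.mem_ofPred_eq, add_right_comm] at this) p
      (fun ζ hζ => by have := hp ζ hζ; dsimp only at this; rwa [add_right_comm] at this) ζ hζ
    dsimp only
    rwa [add_right_comm]

theorem SubH.of_forall_nhds {n : ℕ} {Ω : Set (Fin n → ℂ)} {u : (Fin n → ℂ) → EReal}
    (h : ∀ z ∈ Ω, ∃ N, IsOpen N ∧ z ∈ N ∧ SubH N u) : SubH Ω u := by
  refine SubH.of_local ?_ ?_ ?_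
  · intro z hz y hy
    obtain ⟨N, hN, hzN, hu⟩ := h z hz
    have := hu.1 z hzN y hy
    rw [hN.nhdsWithin_eq hzN] at this
    exact this.filter_mono nhdsWithin_le_nhds
  · intro z hz
    obtain ⟨N, hN, hzN, hu⟩ := h z hz
    exact hu.2.1 z hzN
  · intro z hz w
    obtain ⟨N, hN, hzN, hu⟩ := h z hz
    obtain ⟨s₀, hs₀, hD⟩ := hN.exists_disc_subset hzN w
    exact ⟨s₀, hs₀, fun s hs hs' p hp => hu.center hzN hs (hD s hs') hp⟩

/-- Walsh's theorem: over a B-regular domain, the largest plurisubharmonic minorant of a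
plurisuperharmonic function continuous up to the boundary is continuous up to the boundary. -/
theorem BRegular.exists_continuous_envelope {n : ℕ} (i : Fin n) {Ω : Set (Fin n → ℂ)}
    (hΩ : IsOpen Ω) (hΩb : Bornology.IsBounded Ω) (hreg : BRegular Ω) {f : (Fin n → ℂ) → ℝ}
    (hf : ContinuousOn f (closure Ω)) (hfs : SubH Ω fun z => ((-f z : ℝ) : EReal)) :
    ∃ V : (Fin n → ℂ) → ℝ, ContinuousOn V (closure Ω) ∧ IsPSH Ω (fun z => (V z : EReal)) ∧
      (∀ z ∈ Ω, V z ≤ f z) ∧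
      ∀ u, SubH Ω u → (∀ z ∈ Ω, u z ≤ f z) → ∀ z ∈ Ω, u z ≤ V z := by
  obtain ⟨u₀, hu₀, hu₀c, hu₀f⟩ := hreg f (hf.mono frontier_subset_closure)
  have hK : IsCompact (closure Ω) := hΩb.isCompact_closure
  have hle : ∀ z ∈ Ω, u₀ z ≤ f z := by
    intro z hz
    have := SubH.nonpos_of_frontier i hΩ hΩb (hu₀c.add hf.neg)
      ((hu₀.subH.add hΩ hfs).congr fun z _ => (EReal.coe_add _ _).symm) (fun z hz => by
        simp [hu₀f z hz]) z hz
    simpa using this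
  set F : Set ((Fin n → ℂ) → EReal) := {u | SubH Ω u ∧ ∀ z ∈ Ω, u z ≤ f z} with hF
  set U : (Fin n → ℂ) → EReal := fun z => ⨆ u ∈ F, u z with hUdef
  have hUF : ∀ z, ∀ u ∈ F, u z ≤ U z := fun z u hu => le_iSup₂ (f := fun u (_ : u ∈ F) => u z) u hu
  have hUf : ∀ z ∈ Ω, U z ≤ f z := fun z hz => iSup₂_le fun u hu => hu.2 z hz
  have hUsf : ∀ z ∈ Ω, uscReg Ω U z ≤ f z := by
    intro z hz
    have : NeBot (𝓝[Ω] z) := mem_closure_iff_nhdsWithin_neBot.1 (subset_closure hz)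
    have ht : Tendsto (fun x => (f x : EReal)) (𝓝[Ω] z) (𝓝 (f z)) :=
      (continuous_coe_real_ereal.tendsto _).comp
        ((hf z (subset_closure hz)).mono subset_closure)
    rw [← ht.limsup_eq]
    exact limsup_le_limsup (eventually_nhdsWithin_of_forall hUf)
  have hUs : SubH Ω (uscReg Ω U) := subH_uscReg hΩ (F := F) (fun u hu => hu.1)
    (fun z _ => hUF z) (fun z _ b hb => iSup₂_le hb)
    (fun z hz => ne_top_of_le_ne_top (EReal.coe_ne_top _) (hUsf z hz))
  have hUeq : ∀ z ∈ Ω, uscReg Ω U z = U z := fun z hz =>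
    le_antisymm (hUF z _ ⟨hUs, hUsf⟩) (le_uscReg hz U)
  have hUsub : SubH Ω U := hUs.congr hUeq
  have hu₀U : ∀ z, (u₀ z : EReal) ≤ U z := fun z =>
    hUF z (fun z => (u₀ z : EReal)) ⟨hu₀.subH, fun z hz => EReal.coe_le_coe_iff.2 (hle z hz)⟩
  classical
  set V : (Fin n → ℂ) → ℝ := fun z => if z ∈ Ω then (U z).toReal else f z with hV
  have hVU : ∀ z ∈ Ω, (V z : EReal) = U z := by
    intro z hz
    simp only [hV, if_pos hz]
    exact EReal.coe_toReal (hUsub.2.1 z hz)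
      (ne_bot_of_le_ne_bot (EReal.coe_ne_bot _) (hu₀U z))
  have hVs : SubH Ω fun z => (V z : EReal) := hUsub.congr fun z hz => (hVU z hz).symm
  have hVf : ∀ z ∈ Ω, V z ≤ f z := fun z hz => by
    rw [← EReal.coe_le_coe_iff, hVU z hz]; exact hUf z hz
  have hu₀V : ∀ z ∈ Ω, u₀ z ≤ V z := fun z hz => by
    rw [← EReal.coe_le_coe_iff, hVU z hz]; exact hu₀U z
  have hmax : ∀ u, SubH Ω u → (∀ z ∈ Ω, u z ≤ f z) → ∀ z ∈ Ω, u z ≤ V z :=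
    fun u hu huf z hz => by rw [hVU z hz]; exact hUF z u ⟨hu, huf⟩
  have hunif : ∀ ε : ℝ, 0 < ε → ∃ δ > 0, ∀ z ∈ Ω, ∀ h, z + h ∈ Ω → ‖h‖ < δ →
      V (z + h) ≤ V z + 2 * ε := by
    intro ε hε
    obtain ⟨δ₁, hδ₁, H₁⟩ := Metric.uniformContinuousOn_iff.1
      (hK.uniformContinuousOn_of_continuous hf) ε hε
    obtain ⟨δ₂, hδ₂, H₂⟩ := Metric.uniformContinuousOn_iff.1
      (hK.uniformContinuousOn_of_continuous hu₀c) ε hε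
    refine ⟨min δ₁ δ₂, lt_min hδ₁ hδ₂, fun z hz h hzh hh => ?_⟩
    have hf' : ∀ x ∈ Ω, x + h ∈ Ω → f (x + h) ≤ f x + ε := fun x hx hxh => by
      have := H₁ (x + h) (subset_closure hxh) x (subset_closure hx)
        (by simpa using hh.trans_le (min_le_left _ _))
      rw [Real.dist_eq] at this
      linarith [(abs_lt.1 this).2]
    have hu' : ∀ x ∈ Ω, x + h ∈ Ω → u₀ (x + h) ≤ u₀ x + ε := fun x hx hxh => by
      have := H₂ (x + h) (subset_closure hxh) x (subset_closure hx)
        (by simpa using hh.trans_le (min_le_right _ _))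
      rw [Real.dist_eq] at this
      linarith [(abs_lt.1 this).2]
    have hclosed : IsClosed {x ∈ closure Ω | ε ≤ f x - u₀ x} := by
      have : IsClosed (closure Ω ∩ (fun x => f x - u₀ x) ⁻¹' Ici ε) :=
        (hf.sub hu₀c).preimage_isClosed_of_isClosed isClosed_closure isClosed_Ici
      exact this
    let v : (Fin n → ℂ) → EReal := fun x =>
      if x + h ∈ Ω then max (u₀ x : EReal) (V (x + h) + ((-(2 * ε) : ℝ) : EReal)) else u₀ x
    have hv : SubH Ω v := by
      refine SubH.of_forall_nhds fun x hx => ?_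
      have hadd : Continuous fun x : Fin n → ℂ => x + h := by fun_prop
      by_cases hxh : x + h ∈ Ω
      · have hN : IsOpen (Ω ∩ {x | x + h ∈ Ω}) := hΩ.inter (hΩ.preimage hadd)
        refine ⟨Ω ∩ {x | x + h ∈ Ω}, hN, ⟨hx, hxh⟩, ?_⟩
        refine SubH.congr (SubH.sup (hu₀.subH.mono inter_subset_left)
          (SubH.add hN ((hVs.translate h).mono inter_subset_right) (subH_const _ (-(2 * ε)))))
          fun y hy => ?_
        simp only [v]
        rw [if_pos (show y + h ∈ Ω from hy.2)]
      · have hN : IsOpen (Ω ∩ {x | x + h ∉ {x ∈ closure Ω | ε ≤ f x - u₀ x}}) :=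
          hΩ.inter (hclosed.isOpen_compl.preimage hadd)
        refine ⟨_, hN, ⟨hx, ?_⟩, ?_⟩
        · rintro ⟨h1, h2⟩
          have := hu₀f (x + h) ⟨h1, by rwa [hΩ.interior_eq]⟩
          linarith
        · refine (hu₀.subH.mono inter_subset_left).congr fun y hy => ?_
          simp only [v]
          split_ifs with hyh
          · rw [max_eq_left]
            rw [← EReal.coe_add, EReal.coe_le_coe_iff]
            have h1 : f (y + h) - u₀ (y + h) < ε := by
              by_contra hcon
              exact hy.2 ⟨subset_closure hyh, not_lt.1 hcon⟩
            have h2 := hVf _ hyh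
            have h3 := hu' y hy.1 hyh
            linarith
          · rfl
    have hvf : ∀ x ∈ Ω, v x ≤ f x := by
      intro x hx
      simp only [v]
      split_ifs with hxh
      · refine max_le (EReal.coe_le_coe_iff.2 (hle x hx)) ?_
        rw [← EReal.coe_add, EReal.coe_le_coe_iff]
        linarith [hVf _ hxh, hf' x hx hxh]
      · exact EReal.coe_le_coe_iff.2 (hle x hx)
    have := hmax v hv hvf z hz
    simp only [v, if_pos hzh] at this
    have := (le_max_right _ _).trans this
    rw [← EReal.coe_add, EReal.coe_le_coe_iff] at this
    linarith
  refine ⟨V, fun ξ hξ => ?_, ?_, hVf, hmax⟩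
  · by_cases hξΩ : ξ ∈ Ω
    · refine ContinuousAt.continuousWithinAt ?_
      rw [Metric.continuousAt_iff]
      intro ε hε
      obtain ⟨δ, hδ, H⟩ := hunif (ε / 3) (by positivity)
      obtain ⟨ρ, hρ, hball⟩ := Metric.isOpen_iff.1 hΩ ξ hξΩ
      refine ⟨min δ ρ, lt_min hδ hρ, fun {x} hx => ?_⟩
      have hxΩ : x ∈ Ω := hball (hx.trans_le (min_le_right _ _))
      have hxδ : dist x ξ < δ := hx.trans_le (min_le_left _ _)
      have h1 := H ξ hξΩ (x - ξ) (by simpa using hxΩ) (by rwa [← dist_eq_norm])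
      have h2 := H x hxΩ (ξ - x) (by simpa using hξΩ) (by rwa [← dist_eq_norm, dist_comm])
      rw [add_sub_cancel] at h1 h2
      rw [Real.dist_eq, abs_lt]
      constructor <;> linarith
    · have hξf : ξ ∈ frontier Ω := ⟨hξ, by rwa [hΩ.interior_eq]⟩
      have hcl : ∀ x ∈ closure Ω, u₀ x ≤ V x ∧ V x ≤ f x := by
        intro x hx
        by_cases hxΩ : x ∈ Ω
        · exact ⟨hu₀V x hxΩ, hVf x hxΩ⟩
        · have := hu₀f x ⟨hx, by rwa [hΩ.interior_eq]⟩
          simp [hV, hxΩ, this]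
      have hVξ : V ξ = f ξ := by simp [hV, hξΩ]
      rw [ContinuousWithinAt, hVξ]
      refine tendsto_of_tendsto_of_tendsto_of_le_of_le' (g := u₀) (h := f) ?_ (hf ξ hξ)
        (eventually_nhdsWithin_of_forall fun x hx => (hcl x hx).1)
        (eventually_nhdsWithin_of_forall fun x hx => (hcl x hx).2)
      rw [← hu₀f ξ hξf]
      exact hu₀c ξ hξ
  · obtain ⟨z, hz, -⟩ := (isPSH_iff.1 hu₀).2
    exact isPSH_iff.2 ⟨hVs, z, hz, EReal.coe_ne_bot _⟩

theorem lscReg_le {n : ℕ} {Ω : Set (Fin n → ℂ)} {z : Fin n → ℂ} (hz : z ∈ Ω)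
    (U : (Fin n → ℂ) → EReal) : lscReg Ω U z ≤ U z := by
  refine liminf_le_of_frequently_le ?_
  rw [frequently_iff]
  intro s hs
  exact ⟨z, mem_of_mem_nhdsWithin hz hs, le_rfl⟩

theorem uscReg_le_lscReg_iff {n : ℕ} {Ω : Set (Fin n → ℂ)} {φ : (Fin n → ℂ) → EReal}
    (hcont : ∀ ξ ∈ closure Ω, uscReg Ω φ ξ = lscReg Ω φ ξ) (u : (Fin n → ℂ) → EReal) :
    (∀ ξ ∈ closure Ω, uscReg Ω u ξ ≤ lscReg Ω φ ξ) ↔ ∀ z ∈ Ω, u z ≤ φ z := by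
  refine ⟨fun h z hz => (le_uscReg hz u).trans ((h z (subset_closure hz)).trans (lscReg_le hz φ)),
    fun h ξ hξ => ?_⟩
  rw [← hcont ξ hξ]
  exact limsup_le_limsup (eventually_nhdsWithin_of_forall h)

theorem tendsto_lscReg {n : ℕ} {Ω : Set (Fin n → ℂ)} {φ : (Fin n → ℂ) → EReal}
    (hcont : ∀ ξ ∈ closure Ω, uscReg Ω φ ξ = lscReg Ω φ ξ) {ξ : Fin n → ℂ}
    (hξ : ξ ∈ closure Ω) : Tendsto φ (𝓝[Ω] ξ) (𝓝 (lscReg Ω φ ξ)) :=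
  tendsto_of_liminf_eq_limsup rfl (hcont ξ hξ)

theorem lscReg_eq_self {n : ℕ} {Ω : Set (Fin n → ℂ)} {φ : (Fin n → ℂ) → EReal}
    (hcont : ∀ ξ ∈ closure Ω, uscReg Ω φ ξ = lscReg Ω φ ξ) {z : Fin n → ℂ}
    (hz : z ∈ Ω) : lscReg Ω φ z = φ z :=
  (lscReg_le hz φ).antisymm ((le_uscReg hz φ).trans (hcont z (subset_closure hz)).le)

theorem continuousOn_of_uscReg_eq {n : ℕ} {Ω : Set (Fin n → ℂ)} {φ : (Fin n → ℂ) → EReal}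
    (hcont : ∀ ξ ∈ closure Ω, uscReg Ω φ ξ = lscReg Ω φ ξ) : ContinuousOn φ Ω := by
  intro z hz
  have := tendsto_lscReg hcont (subset_closure hz)
  rwa [lscReg_eq_self hcont hz] at this

theorem exists_truncation {n : ℕ} {Ω : Set (Fin n → ℂ)} {φ : (Fin n → ℂ) → EReal}
    (hφ : SubH Ω fun z => -φ z) {c : ℝ} (hlb : ∀ z ∈ Ω, (c : EReal) ≤ φ z)
    (hcont : ∀ ξ ∈ closure Ω, uscReg Ω φ ξ = lscReg Ω φ ξ) (lam : ℝ) :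
    ∃ f : (Fin n → ℂ) → ℝ, ContinuousOn f (closure Ω) ∧
      SubH Ω (fun z => ((-f z : ℝ) : EReal)) ∧ ∀ z ∈ Ω, (f z : EReal) = min (φ z) lam := by
  have hlim : ∀ ξ ∈ closure Ω, ∃ y, Tendsto φ (𝓝[Ω] ξ) (𝓝 y) := fun ξ hξ =>
    ⟨_, tendsto_lscReg hcont hξ⟩
  have hΦc : ContinuousOn (extendFrom Ω φ) (closure Ω) := continuousOn_extendFrom subset_rfl hlim
  have hΦ : ∀ z ∈ Ω, extendFrom Ω φ z = φ z := fun z hz =>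
    extendFrom_eq (subset_closure hz) (continuousOn_of_uscReg_eq hcont z hz)
  have hΦlb : ∀ ξ ∈ closure Ω, (c : EReal) ≤ extendFrom Ω φ ξ := by
    intro ξ hξ
    have : NeBot (𝓝[Ω] ξ) := mem_closure_iff_nhdsWithin_neBot.1 hξ
    exact ge_of_tendsto (tendsto_extendFrom (hlim ξ hξ)) (eventually_nhdsWithin_of_forall hlb)
  have hmem : ∀ ξ ∈ closure Ω, min (extendFrom Ω φ ξ) (lam : EReal) ∈ ({⊥, ⊤}ᶜ : Set EReal) := by
    intro ξ hξ
    simp only [mem_compl_iff, mem_insert_iff, mem_singleton_iff, not_or]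
    refine ⟨ne_bot_of_le_ne_bot (EReal.coe_ne_bot (min c lam)) ?_,
      ne_top_of_le_ne_top (EReal.coe_ne_top lam) (min_le_right _ _)⟩
    refine le_min ((EReal.coe_le_coe_iff.2 (min_le_left _ _)).trans (hΦlb ξ hξ))
      (EReal.coe_le_coe_iff.2 (min_le_right _ _))
  have hcoe : ∀ z ∈ Ω, (((min (extendFrom Ω φ z) (lam : EReal)).toReal : ℝ) : EReal)
      = min (φ z) lam := by
    intro z hz
    have := hmem z (subset_closure hz)
    simp only [mem_compl_iff, mem_insert_iff, mem_singleton_iff, not_or] at this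
    rw [EReal.coe_toReal this.2 this.1, hΦ z hz]
  refine ⟨fun z => (min (extendFrom Ω φ z) (lam : EReal)).toReal, ?_, ?_, hcoe⟩
  · exact EReal.continuousOn_toReal.comp (ContinuousOn.inf hΦc continuousOn_const) hmem
  · refine (hφ.sup (subH_const Ω (-lam))).congr fun z hz => ?_
    dsimp only
    rw [EReal.coe_neg, EReal.coe_neg, hcoe z hz]
    exact (EReal.max_neg_neg _ _)

section Reduced

variable {n : ℕ} {Ω : Set (Fin n → ℂ)} {φ : (Fin n → ℂ) → EReal} {lam : ℝ}

theorem le_Rop {z : Fin n → ℂ} (hz : z ∈ Ω) :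
    max (φ z - (lam : EReal)) 0 ≤ Rop Ω φ lam z := by
  refine le_sInf ?_
  rintro _ ⟨v, -, hv, rfl⟩
  exact hv z hz

theorem Slam_nonneg {z : Fin n → ℂ} : 0 ≤ Slam Ω φ lam z :=
  le_liminf_of_le (h := eventually_nhdsWithin_of_forall fun _ hx =>
    (le_max_right _ _).trans (le_Rop hx))

theorem sub_le_Slam (hcont : ContinuousOn φ Ω) {z : Fin n → ℂ} (hz : z ∈ Ω) :
    φ z - (lam : EReal) ≤ Slam Ω φ lam z := by
  have : NeBot (𝓝[Ω] z) := mem_closure_iff_nhdsWithin_neBot.1 (subset_closure hz)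
  have ht : Tendsto (fun x => φ x - (lam : EReal)) (𝓝[Ω] z) (𝓝 (φ z - lam)) := by
    simp only [sub_eq_add_neg, ← EReal.coe_neg]
    exact (EReal.continuousAt_add (p := (φ z, ((-lam : ℝ) : EReal))) (Or.inr (by simp))
      (Or.inr (by simp))).tendsto.comp ((hcont z hz).tendsto.prodMk_nhds tendsto_const_nhds)
  rw [← ht.liminf_eq]
  exact liminf_le_liminf (eventually_nhdsWithin_of_forall fun x hx =>
    (le_max_left _ _).trans (le_Rop hx))

theorem subH_neg_Slam (hΩ : IsOpen Ω) : SubH Ω fun z => -Slam Ω φ lam z := by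
  have heq : (fun z => -Slam Ω φ lam z) = uscReg Ω fun z => -Rop Ω φ lam z := by
    funext z
    exact EReal.limsup_neg.symm
  have htop : ∀ z ∈ Ω, -Slam Ω φ lam z ≠ ⊤ := fun z _ => by
    rw [Ne, EReal.neg_eq_top_iff]
    exact ne_bot_of_le_ne_bot (by simp) (Slam_nonneg (Ω := Ω) (φ := φ) (lam := lam))
  rw [heq]
  refine subH_uscReg hΩ (F := {u | ∃ v, IsPSupH Ω v ∧
    (∀ ζ ∈ Ω, max (φ ζ - (lam : EReal)) 0 ≤ v ζ) ∧ u = fun z => -v z}) ?_ ?_ ?_ ?_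
  · rintro _ ⟨v, hv, -, rfl⟩
    exact hv.subH
  · rintro z _ _ ⟨v, hv, hv', rfl⟩
    exact EReal.neg_le_neg_iff.2 (sInf_le ⟨v, hv, hv', rfl⟩)
  · intro z _ b hb
    rw [EReal.neg_le]
    refine le_sInf ?_
    rintro _ ⟨v, hv, hv', rfl⟩
    rw [EReal.neg_le]
    exact hb _ ⟨v, hv, hv', rfl⟩
  · intro z hz
    rw [← congrFun heq z]
    exact htop z hz

theorem SubH.add_neg_Slam_le_min (hcont : ContinuousOn φ Ω) {u : (Fin n → ℂ) → EReal}
    {z : Fin n → ℂ} (hz : z ∈ Ω) (hu : u z ≤ φ z) :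
    u z + -Slam Ω φ lam z ≤ min (φ z) lam := by
  have h0 : 0 ≤ Slam Ω φ lam z := Slam_nonneg
  have h1 := sub_le_Slam (lam := lam) hcont hz
  refine le_min ?_ ?_
  · calc u z + -Slam Ω φ lam z ≤ φ z + 0 := by
          gcongr
          rwa [EReal.neg_le, neg_zero]
      _ = φ z := add_zero _
  · refine (add_le_add_left hu _).trans ?_
    generalize Slam Ω φ lam z = S at *
    generalize φ z = x at *
    induction S with
    | top => simp
    | bot => simp at h0
    | coe S =>
      induction x with
      | top => simp at h1
      | bot => simp
      | coe x =>
        norm_cast at h1 ⊢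
        linarith

end Reduced

section BallAverages

open MeasureTheory AddCircle ENNReal

theorem measurePreserving_circle_smul {n : ℕ} (t : UnitAddCircle) :
    MeasurePreserving fun w : Fin n → ℂ => circPt t • w := by
  have h := (rotation (AddCircle.toCircle t)).measurePreserving
  exact volume_preserving_pi (f := fun _ : Fin n => rotation (AddCircle.toCircle t)) fun _ => h

theorem setLIntegral_ball_circle_average {n : ℕ} {R : ℝ} {G : (Fin n → ℂ) → ℝ≥0∞}
    (hG : Measurable G) :
    ∫⁻ w in Metric.ball 0 R, (∫⁻ t, G (circPt t • w) ∂haarAddCircle) =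
      ∫⁻ w in Metric.ball 0 R, G w := by
  have hc := continuous_circPt
  rw [lintegral_lintegral_swap]
  · have : ∀ t, ∫⁻ w in Metric.ball 0 R, G (circPt t • w) = ∫⁻ w in Metric.ball 0 R, G w := by
      intro t
      have h := (measurePreserving_circle_smul (n := n) t).setLIntegral_comp_preimage
        (measurableSet_ball (x := 0) (ε := R)) hG
      rw [← h]
      congr 2
      ext w
      simp [norm_smul]
    simp [this]
  · refine (hG.comp ?_).aemeasurable
    have : Continuous fun x : (Fin n → ℂ) × UnitAddCircle => circPt x.2 • x.1 := by fun_prop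
    exact this.measurable

theorem setLIntegral_ball_center {n : ℕ} {R : ℝ} (z : Fin n → ℂ) {G : (Fin n → ℂ) → ℝ≥0∞}
    (hG : Measurable G) :
    ∫⁻ w in Metric.ball z R, G w = ∫⁻ w in Metric.ball 0 R, G (z + w) := by
  have h := (measurePreserving_add_left (volume : Measure (Fin n → ℂ)) z).setLIntegral_comp_preimage
        (measurableSet_ball (x := z) (ε := R)) hG
  rw [← h]
  congr 2
  ext w
  simp

/-- Nonnegative part of `v` extended by zero off `Ω`. -/
def extZero {n : ℕ} (Ω : Set (Fin n → ℂ)) (v : (Fin n → ℂ) → EReal) : (Fin n → ℂ) → ℝ≥0∞ :=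
  Ω.indicator fun z => (v z).toENNReal

theorem measurable_extZero {n : ℕ} {Ω : Set (Fin n → ℂ)} (hΩ : IsOpen Ω)
    {v : (Fin n → ℂ) → EReal} (hv : LowerSemicontinuousOn v Ω) : Measurable (extZero Ω v) := by
  refine LowerSemicontinuous.measurable fun z y hy => ?_
  by_cases hz : z ∈ Ω
  · have h1 := hv z hz
    rw [extZero, indicator_of_mem hz] at hy
    have hy' : (y : EReal) < v z := by
      by_contra hcon
      have := EReal.toENNReal_le_toENNReal (not_lt.1 hcon)
      rw [EReal.toENNReal_coe] at this
      exact absurd hy (not_lt.2 this)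
    have h2 := h1 _ hy'
    rw [hΩ.nhdsWithin_eq hz] at h2
    filter_upwards [h2, hΩ.mem_nhds hz] with x hx hxΩ
    rw [extZero, indicator_of_mem hxΩ]
    by_contra hcon
    have := ((le_max_right 0 (v x)).trans_eq EReal.coe_toENNReal_eq_max.symm).trans
      (EReal.coe_ennreal_le_coe_ennreal_iff.2 (not_lt.1 hcon))
    exact absurd hx (not_lt.2 this)
  · simp [extZero, hz] at hy

/-- Sub-mean value property of `-v` on circles. -/
theorem lintegral_circle_le {n : ℕ} {Ω : Set (Fin n → ℂ)} {v : (Fin n → ℂ) → EReal}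
    (hv : SubH Ω fun z => -v z) (hv0 : ∀ z ∈ Ω, 0 ≤ v z) {z w : Fin n → ℂ} {s : ℝ} (hs : 0 < s)
    (hD : ∀ ζ : ℂ, ‖ζ‖ ≤ s → z + ζ • w ∈ Ω) :
    ∫⁻ t, (v (z + ((s : ℂ) * circPt t) • w)).toENNReal ∂haarAddCircle ≤ (v z).toENNReal := by
  have hz : z ∈ Ω := by simpa using hD 0 (by simpa using hs.le)
  have hmem := fun t => hD _ (norm_mul_circPt hs.le t).le
  set g : UnitAddCircle → EReal := fun t => v (z + ((s : ℂ) * circPt t) • w) with hg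
  have hgl : LowerSemicontinuous g := by
    have := continuous_neg.comp_upperSemicontinuous_antitone
      (SubH.usc_circle hv.1 hs.le hD) (fun a b h => EReal.neg_le_neg_iff.2 h)
    simpa [Function.comp_def] using this
  have hgm : Measurable fun t => (g t).toENNReal := hgl.measurable.ereal_toENNReal
  have hg0 : ∀ t, 0 ≤ g t := fun t => hv0 _ (hmem t)
  by_cases hvz : v z = ⊤
  · simp [hvz]
  have hvz0 := hv0 z hz
  lift v z to ℝ using ⟨hvz, ne_bot_of_le_ne_bot (by simp) hvz0⟩ with x hx
  have hx0 : 0 ≤ x := by exact_mod_cast hvz0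
  have trunc : ∀ k : ℕ, ∫⁻ t, min ((g t).toENNReal) k ∂haarAddCircle ≤ ENNReal.ofReal x := by
    intro k
    refine ENNReal.le_of_forall_pos_le_add fun ε hε _ => ?_
    set δ : ℝ := ε / 4 with hδ
    have hδ0 : 0 < δ := by have : (0 : ℝ) < ε := hε
                           positivity
    have hFtop : ∀ t, min ((g t).toENNReal) k ≠ ∞ := fun t =>
      ne_top_of_le_ne_top (natCast_ne_top k) (min_le_right _ _)
    have hF : ∀ t, ((min ((g t).toENNReal) (k : ℝ≥0∞)).toNNReal : ℝ≥0∞) = min ((g t).toENNReal) k :=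
      fun t => ENNReal.coe_toNNReal (hFtop t)
    obtain ⟨h, hhF, husc, hint⟩ := exists_upperSemicontinuous_le_lintegral_le
      (μ := haarAddCircle) (fun t => (min ((g t).toENNReal) (k : ℝ≥0∞)).toNNReal) (by
        simp_rw [hF]
        refine ne_top_of_le_ne_top (natCast_ne_top k) ?_
        calc _ ≤ ∫⁻ _ : UnitAddCircle, (k : ℝ≥0∞) ∂haarAddCircle :=
              lintegral_mono fun t => min_le_right _ _
          _ = k := by simp) (ε := ENNReal.ofReal δ) (by simpa using hδ0)
    have hhg : ∀ t, ((h t : ℝ) : EReal) ≤ g t := by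
      intro t
      have h1 : (h t : ℝ≥0∞) ≤ (g t).toENNReal :=
        (ENNReal.coe_le_coe.2 (hhF t)).trans ((hF t).le.trans (min_le_left _ _))
      have h2 := EReal.coe_ennreal_le_coe_ennreal_iff.2 h1
      rwa [EReal.coe_toENNReal (hg0 t)] at h2
    have hbetween : ∃ f : C(UnitAddCircle, ℝ), ∀ t, ((h t : ℝ) : EReal) < f t ∧
        (f t : EReal) < g t + (δ : EReal) := by
      refine exists_continuous_between ?_ ?_ ?_
      · exact (continuous_coe_real_ereal.comp NNReal.continuous_coe).comp_upperSemicontinuous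
          husc fun a b hab => EReal.coe_le_coe_iff.2 (NNReal.coe_le_coe.2 hab)
      · exact LowerSemicontinuous.add' hgl lowerSemicontinuous_const fun t =>
          EReal.continuousAt_add (Or.inr (by simp)) (Or.inr (by simp))
      · intro t
        refine lt_of_lt_of_le ?_ (add_le_add_left (hhg t) _)
        rw [← EReal.coe_add, EReal.coe_lt_coe_iff]
        linarith
    obtain ⟨f, hf⟩ := hbetween
    obtain ⟨p, hp⟩ := exists_polynomial_re_near hs f hδ0
    have hc : -v z ≤ (((-p + C ((2 * δ : ℝ) : ℂ)).eval 0).re : ℝ) := by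
      refine hv.center hz hs hD fun ζ hζ => ?_
      obtain ⟨t, rfl⟩ := exists_circPt hs hζ
      have h1 := (hf t).2
      have h2 := abs_lt.1 (hp t)
      simp only [hg] at h1
      generalize v (z + ((s : ℂ) * circPt t) • w) = y at *
      induction y with
      | top => simp
      | bot => simp at h1
      | coe y =>
        rw [← EReal.coe_add, EReal.coe_lt_coe_iff] at h1
        rw [← EReal.coe_neg, EReal.coe_le_coe_iff]
        simp only [eval_add, eval_neg, eval_C, Complex.add_re, Complex.neg_re, Complex.ofReal_re]
        linarith
    rw [← hx, ← EReal.coe_neg, EReal.coe_le_coe_iff] at hc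
    simp only [eval_add, eval_neg, eval_C, Complex.add_re, Complex.neg_re, Complex.ofReal_re,
      ← integral_eval_circPt p s] at hc
    have hfi : Integrable f haarAddCircle := f.continuous.integrable_of_hasCompactSupport
      (HasCompactSupport.of_compactSpace _)
    have hpi : Integrable (fun t => (p.eval ((s : ℂ) * circPt t)).re) haarAddCircle :=
      (continuous_eval_circPt p s).integrable_of_hasCompactSupport
        (HasCompactSupport.of_compactSpace _)
    have hmono : ∫ t, f t ∂haarAddCircle ≤
        ∫ t, ((p.eval ((s : ℂ) * circPt t)).re + δ) ∂haarAddCircle :=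
      integral_mono hfi (hpi.add (integrable_const _)) fun t => by
        have := abs_lt.1 (hp t)
        dsimp only
        linarith
    rw [integral_add hpi (integrable_const _)] at hmono
    simp only [integral_const, probReal_univ, smul_eq_mul, one_mul] at hmono
    calc ∫⁻ t, min ((g t).toENNReal) k ∂haarAddCircle
        ≤ ∫⁻ t, h t ∂haarAddCircle + ENNReal.ofReal δ := by simpa only [hF] using hint
      _ ≤ ∫⁻ t, ENNReal.ofReal (f t) ∂haarAddCircle + ENNReal.ofReal δ := by
          gcongr with t
          rw [← ENNReal.ofReal_coe_nnreal]
          exact ENNReal.ofReal_le_ofReal (EReal.coe_le_coe_iff.1 (hf t).1.le)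
      _ = ENNReal.ofReal (∫ t, f t ∂haarAddCircle) + ENNReal.ofReal δ := by
          rw [ofReal_integral_eq_lintegral_ofReal hfi]
          exact Eventually.of_forall fun t => 
            (h t).2.trans (EReal.coe_le_coe_iff.1 (hf t).1.le)
      _ ≤ ENNReal.ofReal (x + 3 * δ) + ENNReal.ofReal δ := by
          gcongr
          linarith
      _ = ENNReal.ofReal x + ε := by
          rw [← ENNReal.ofReal_add (by positivity) hδ0.le, ← ENNReal.ofReal_coe_nnreal (p := ε),
            ← ENNReal.ofReal_add hx0 (NNReal.coe_nonneg ε)]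
          congr 1
          rw [hδ]
          ring
  have hsup : ∀ t, (g t).toENNReal = ⨆ k : ℕ, min ((g t).toENNReal) k := by
    intro t
    refine le_antisymm ?_ (iSup_le fun k => min_le_left _ _)
    rw [← inf_iSup_eq (a := (g t).toENNReal) (f := fun k : ℕ => (k : ℝ≥0∞)), iSup_natCast]
    simp
  rw [EReal.real_coe_toENNReal]
  rw [lintegral_congr hsup, lintegral_iSup (fun k => hgm.min measurable_const) fun i j hij t =>
    min_le_min_left _ (by exact_mod_cast hij)]
  exact iSup_le trunc

/-- A subharmonic function is bounded by the circle averages of its majorants. -/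
theorem le_lintegral_circle {n : ℕ} {Ω : Set (Fin n → ℂ)} {u ψ : (Fin n → ℂ) → EReal}
    (hu : SubH Ω u) (hu0 : ∀ z ∈ Ω, 0 ≤ u z) (hψ : ContinuousOn ψ Ω)
    (hle : ∀ z ∈ Ω, u z ≤ ψ z) {z w : Fin n → ℂ} {s : ℝ} (hs : 0 < s)
    (hD : ∀ ζ : ℂ, ‖ζ‖ ≤ s → z + ζ • w ∈ Ω) :
    (u z).toENNReal ≤ ∫⁻ t, (ψ (z + ((s : ℂ) * circPt t) • w)).toENNReal ∂haarAddCircle := by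
  have hz : z ∈ Ω := by simpa using hD 0 (by simpa using hs.le)
  have hmem := fun t => hD _ (norm_mul_circPt hs.le t).le
  have hcirc := continuous_circPt
  obtain ⟨t₀, -, ht₀⟩ := UpperSemicontinuousOn.exists_isMaxOn (univ_nonempty) isCompact_univ
    ((SubH.usc_circle hu.1 hs.le hD).upperSemicontinuousOn univ)
  set M : EReal := u (z + ((s : ℂ) * circPt t₀) • w) with hM
  have hMtop : M ≠ ⊤ := hu.2.1 _ (hmem t₀)
  have hM0 : 0 ≤ M := hu0 _ (hmem t₀)
  have huM : ∀ t, u (z + ((s : ℂ) * circPt t) • w) ≤ M := fun t => ht₀ (mem_univ t)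
  have hbd : ∀ t, 0 ≤ min (ψ (z + ((s : ℂ) * circPt t) • w)) M := fun t =>
    le_min ((hu0 _ (hmem t)).trans (hle _ (hmem t))) hM0
  have hcoe : ∀ t, (((min (ψ (z + ((s : ℂ) * circPt t) • w)) M).toReal : ℝ) : EReal) =
      min (ψ (z + ((s : ℂ) * circPt t) • w)) M := fun t =>
    EReal.coe_toReal (ne_top_of_le_ne_top hMtop (min_le_right _ _))
      (ne_bot_of_le_ne_bot (by simp) (hbd t))
  have hfc : Continuous fun t => (min (ψ (z + ((s : ℂ) * circPt t) • w)) M).toReal := by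
    have h1 : Continuous fun t => min (ψ (z + ((s : ℂ) * circPt t) • w)) M :=
      (hψ.comp_continuous (by fun_prop) hmem).min continuous_const
    refine EReal.continuousOn_toReal.comp_continuous h1 fun t => ?_
    simp only [mem_compl_iff, mem_insert_iff, mem_singleton_iff, not_or]
    exact ⟨ne_bot_of_le_ne_bot (by simp) (hbd t), ne_top_of_le_ne_top hMtop (min_le_right _ _)⟩
  set f : C(UnitAddCircle, ℝ) := ⟨_, hfc⟩ with hf
  have hcoe : ∀ t, (f t : EReal) = min (ψ (z + ((s : ℂ) * circPt t) • w)) M := hcoe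
  have hfi : Integrable f haarAddCircle := f.continuous.integrable_of_hasCompactSupport
    (HasCompactSupport.of_compactSpace _)
  have hf0 : ∀ t, 0 ≤ f t := fun t => EReal.coe_le_coe_iff.1 ((hbd t).trans_eq (hcoe t).symm)
  have key : u z ≤ ((∫ t, f t ∂haarAddCircle : ℝ) : EReal) := by
    refine EReal.le_of_forall_pos_le_add_coe fun ε hε => ?_
    obtain ⟨p, hp⟩ := exists_polynomial_re_near hs f (half_pos hε)
    have hc : u z ≤ (((p + C ((ε / 2 : ℝ) : ℂ)).eval 0).re : ℝ) := by
      refine hu.center hz hs hD fun ζ hζ => ?_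
      obtain ⟨t, rfl⟩ := exists_circPt hs hζ
      refine (le_min (hle _ (hmem t)) (huM t)).trans ((hcoe t).symm.le.trans ?_)
      have := abs_lt.1 (hp t)
      rw [EReal.coe_le_coe_iff]
      simp only [eval_add, eval_C, Complex.add_re, Complex.ofReal_re]
      linarith
    refine hc.trans ?_
    rw [← EReal.coe_add, EReal.coe_le_coe_iff]
    simp only [eval_add, eval_C, Complex.add_re, Complex.ofReal_re, ← integral_eval_circPt p s]
    have hpi : Integrable (fun t => (p.eval ((s : ℂ) * circPt t)).re) haarAddCircle :=
      (continuous_eval_circPt p s).integrable_of_hasCompactSupport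
        (HasCompactSupport.of_compactSpace _)
    have hmono : ∫ t, (p.eval ((s : ℂ) * circPt t)).re ∂haarAddCircle ≤
        ∫ t, (f t + ε / 2) ∂haarAddCircle :=
      integral_mono hpi (hfi.add (integrable_const _)) fun t => by
        have := abs_lt.1 (hp t)
        dsimp only
        linarith
    rw [integral_add hfi (integrable_const _)] at hmono
    simp only [integral_const, probReal_univ, smul_eq_mul, one_mul] at hmono
    linarith
  calc (u z).toENNReal ≤ ENNReal.ofReal (∫ t, f t ∂haarAddCircle) := by
        rw [← EReal.real_coe_toENNReal]
        exact EReal.toENNReal_le_toENNReal key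
    _ = ∫⁻ t, ENNReal.ofReal (f t) ∂haarAddCircle :=
        ofReal_integral_eq_lintegral_ofReal hfi (Eventually.of_forall hf0)
    _ ≤ _ := lintegral_mono fun t => by
        dsimp only
        rw [← EReal.real_coe_toENNReal, hcoe]
        exact EReal.toENNReal_le_toENNReal (min_le_left _ _)

end BallAverages

section LocalBounds

open MeasureTheory AddCircle ENNReal

variable {n : ℕ} {Ω : Set (Fin n → ℂ)}

theorem add_smul_mem_of_ball_subset {z w : Fin n → ℂ} {R : ℝ} (hB : Metric.ball z R ⊆ Ω)
    (hw : w ∈ Metric.ball 0 R) {ζ : ℂ} (hζ : ‖ζ‖ ≤ 1) : z + ζ • w ∈ Ω := by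
  refine hB ?_
  rw [mem_ball_zero_iff] at hw
  rw [Metric.mem_ball, dist_self_add_left, norm_smul]
  nlinarith [norm_nonneg w, norm_nonneg ζ]

theorem lsc_of_neg {v : (Fin n → ℂ) → EReal} (hv : SubH Ω fun z => -v z) :
    LowerSemicontinuousOn v Ω := by
  have := continuous_neg.comp_upperSemicontinuousOn_antitone hv.1
    (fun a b h => EReal.neg_le_neg_iff.2 h)
  simpa [Function.comp_def] using this

theorem setLIntegral_ball_le (hΩ : IsOpen Ω) {v : (Fin n → ℂ) → EReal}
    (hv : SubH Ω fun z => -v z) (hv0 : ∀ z ∈ Ω, 0 ≤ v z) {z : Fin n → ℂ} {R : ℝ}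
    (hB : Metric.ball z R ⊆ Ω) :
    ∫⁻ w in Metric.ball z R, extZero Ω v w ≤
      (v z).toENNReal * volume (Metric.ball (0 : Fin n → ℂ) R) := by
  have hm := measurable_extZero hΩ (lsc_of_neg hv)
  rw [setLIntegral_ball_center z hm,
    ← setLIntegral_ball_circle_average (G := fun w => extZero Ω v (z + w))
      (hm.comp (measurable_const_add z))]
  rw [← setLIntegral_const]
  refine setLIntegral_mono measurable_const fun w hw => ?_
  have h := lintegral_circle_le hv hv0 (z := z) (w := w) one_pos
    fun ζ hζ => add_smul_mem_of_ball_subset hB hw hζ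
  refine le_trans (lintegral_mono fun t => ?_) h
  have hmem := add_smul_mem_of_ball_subset (ζ := circPt t) hB hw (by simp)
  simp [extZero, hmem]

theorem le_setLIntegral_ball (hΩ : IsOpen Ω) {u v : (Fin n → ℂ) → EReal}
    (hu : SubH Ω u) (hu0 : ∀ z ∈ Ω, 0 ≤ u z) (hv : ContinuousOn v Ω)
    (hle : ∀ z ∈ Ω, u z ≤ v z) {z : Fin n → ℂ} {R : ℝ} (hB : Metric.ball z R ⊆ Ω) :
    (u z).toENNReal * volume (Metric.ball (0 : Fin n → ℂ) R) ≤
      ∫⁻ w in Metric.ball z R, extZero Ω v w := by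
  have hm := measurable_extZero hΩ hv.lowerSemicontinuousOn
  rw [setLIntegral_ball_center z hm,
    ← setLIntegral_ball_circle_average (G := fun w => extZero Ω v (z + w))
      (hm.comp (measurable_const_add z))]
  rw [← setLIntegral_const]
  refine setLIntegral_mono' Metric.isOpen_ball.measurableSet fun w hw => ?_
  have h := le_lintegral_circle hu hu0 hv hle (z := z) (w := w) one_pos
    fun ζ hζ => add_smul_mem_of_ball_subset hB hw hζ
  refine le_trans h (lintegral_mono fun t => ?_)
  have hmem := add_smul_mem_of_ball_subset (ζ := circPt t) hB hw (by simp)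
  simp [extZero, hmem]

theorem exists_setLIntegral_ball_lt_top (hΩ : IsOpen Ω) (hΩc : IsPreconnected Ω)
    {v : (Fin n → ℂ) → EReal} (hv : SubH Ω fun z => -v z) (hv0 : ∀ z ∈ Ω, 0 ≤ v z)
    (hfin : ∃ z ∈ Ω, v z ≠ ⊤) {z : Fin n → ℂ} (hz : z ∈ Ω) :
    ∃ r > 0, Metric.ball z r ⊆ Ω ∧ ∫⁻ w in Metric.ball z r, extZero Ω v w < ∞ := by
  set A : Set (Fin n → ℂ) := {z | ∃ r > 0, Metric.ball z r ⊆ Ω ∧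
    ∫⁻ w in Metric.ball z r, extZero Ω v w < ∞} with hA
  have hsub : ∀ {z x : Fin n → ℂ} {r : ℝ}, Metric.ball z r ⊆ Ω →
      ∫⁻ w in Metric.ball z r, extZero Ω v w < ∞ → x ∈ Metric.ball z r → x ∈ A := by
    intro z x r hB hI hx
    obtain ⟨ρ, hρ, hρB⟩ := Metric.isOpen_iff.1 Metric.isOpen_ball x hx
    exact ⟨ρ, hρ, hρB.trans hB, (lintegral_mono_set hρB).trans_lt hI⟩
  have hgood : ∀ {x : Fin n → ℂ} {R : ℝ}, Metric.ball x R ⊆ Ω → v x ≠ ⊤ →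
      ∫⁻ w in Metric.ball x R, extZero Ω v w < ∞ := fun hB hx =>
    (setLIntegral_ball_le hΩ hv hv0 hB).trans_lt
      (ENNReal.mul_lt_top (EReal.toENNReal_ne_top_iff.2 hx).lt_top measure_ball_lt_top)
  have hm := measurable_extZero hΩ (lsc_of_neg hv)
  have hAΩ : Ω ⊆ A := by
    refine hΩc.subset_of_closure_inter_subset ?_ ?_ ?_
    · rw [Metric.isOpen_iff]
      rintro x ⟨r, hr, hB, hI⟩
      exact ⟨r, hr, fun y hy => hsub hB hI hy⟩
    · obtain ⟨x, hx, hx'⟩ := hfin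
      obtain ⟨R, hR, hB⟩ := Metric.isOpen_iff.1 hΩ x hx
      exact ⟨x, hx, R, hR, hB, hgood hB hx'⟩
    · rintro x ⟨hxA, hxΩ⟩
      obtain ⟨R, hR, hB⟩ := Metric.isOpen_iff.1 hΩ x hxΩ
      obtain ⟨y, ⟨r, hr, hBy, hIy⟩, hxy⟩ := Metric.mem_closure_iff.1 hxA (R / 2) (by positivity)
      have hopen : IsOpen (Metric.ball y r ∩ Metric.ball x (R / 2)) :=
        Metric.isOpen_ball.inter Metric.isOpen_ball
      have hpos : volume (Metric.ball y r ∩ Metric.ball x (R / 2)) ≠ 0 :=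
        (hopen.measure_pos _ ⟨y, by simpa using hr, by simpa [dist_comm] using hxy⟩).ne'
      have hae : ∀ᵐ w ∂volume.restrict (Metric.ball y r ∩ Metric.ball x (R / 2)),
          extZero Ω v w < ∞ :=
        ae_lt_top hm ((lintegral_mono_set inter_subset_left).trans_lt hIy).ne
      have hae' := hae.and (ae_restrict_mem hopen.measurableSet)
      have : NeBot (ae (volume.restrict (Metric.ball y r ∩ Metric.ball x (R / 2)))) := by
        rw [ae_neBot]
        simpa [Measure.restrict_eq_zero] using hpos
      obtain ⟨q, hq, hq1, hq2⟩ := hae'.exists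
      have hqΩ : q ∈ Ω := hBy hq1
      rw [extZero, indicator_of_mem hqΩ] at hq
      have hqB : Metric.ball q (R / 2) ⊆ Ω := by
        refine (Metric.ball_subset_ball' ?_).trans hB
        have := Metric.mem_ball.1 hq2
        linarith
      exact hsub hqB (hgood hqB (EReal.toENNReal_ne_top_iff.1 hq.ne))
        (Metric.mem_ball'.1 hq2)
  exact hAΩ hz

/-- The subharmonic minorants of a lower bounded, continuous plurisuperharmonic function are
locally uniformly bounded above. -/
theorem exists_eventually_minorant_le (hΩ : IsOpen Ω) (hΩc : IsPreconnected Ω)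
    {φ : (Fin n → ℂ) → EReal} (hφ : IsPSupH Ω φ) (hφc : ContinuousOn φ Ω) {c : ℝ}
    (hlb : ∀ z ∈ Ω, (c : EReal) ≤ φ z) {z : Fin n → ℂ} (hz : z ∈ Ω) :
    ∃ K : ℝ, ∀ᶠ x in 𝓝 z, ∀ u, SubH Ω u → (∀ y ∈ Ω, u y ≤ φ y) → u x ≤ K := by
  set v : (Fin n → ℂ) → EReal := fun z => φ z + ((-c : ℝ) : EReal) with hv
  have hcadd : ∀ x : EReal, ContinuousAt (fun x : EReal => x + ((-c : ℝ) : EReal)) x := fun x =>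
    (EReal.continuousAt_add (p := (x, ((-c : ℝ) : EReal))) (Or.inr (by simp))
      (Or.inr (by simp))).comp (f := fun x : EReal => (x, ((-c : ℝ) : EReal))) (by fun_prop)
  have hvc : ContinuousOn v Ω := fun z hz => (hcadd (φ z)).comp_continuousWithinAt (hφc z hz)
  have hvs : SubH Ω fun z => -v z := by
    refine (SubH.add hΩ hφ.subH (subH_const Ω c)).congr fun z _ => ?_
    simp only [hv]
    rw [EReal.neg_add (Or.inr (by simp)) (Or.inr (by simp)), sub_eq_add_neg, ← EReal.coe_neg,
      neg_neg]
  have hpos : ∀ x : EReal, (c : EReal) ≤ x → 0 ≤ x + ((-c : ℝ) : EReal) := fun x hx => by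
    refine le_trans ?_ (add_le_add_left hx _)
    rw [← EReal.coe_add]
    simp
  have hv0 : ∀ z ∈ Ω, 0 ≤ v z := fun z hz => hpos _ (hlb z hz)
  have hfin : ∃ z ∈ Ω, v z ≠ ⊤ := by
    obtain ⟨x, hx, hx'⟩ := (isPSH_iff.1 hφ).2
    refine ⟨x, hx, EReal.add_ne_top ?_ (by simp)⟩
    rintro h
    simp [h] at hx'
  obtain ⟨r, hr, hB, hI⟩ := exists_setLIntegral_ball_lt_top hΩ hΩc hvs hv0 hfin hz
  set I := ∫⁻ w in Metric.ball z r, extZero Ω v w with hIdef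
  set m := volume (Metric.ball (0 : Fin n → ℂ) (r / 2)) with hm
  have hm0 : m ≠ 0 := (Metric.measure_ball_pos _ _ (by positivity)).ne'
  have hmtop : m ≠ ∞ := measure_ball_lt_top.ne
  have hK : I / m ≠ ∞ := ENNReal.div_ne_top hI.ne hm0
  refine ⟨(I / m).toReal + c, ?_⟩
  filter_upwards [Metric.ball_mem_nhds z (half_pos hr)] with x hx u hu huφ
  have hxB : Metric.ball x (r / 2) ⊆ Metric.ball z r := Metric.ball_subset_ball' (by
    have := Metric.mem_ball.1 hx
    linarith)
  have hxΩ : x ∈ Ω := hB (Metric.ball_subset_ball (by linarith) hx)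
  have h1 := le_setLIntegral_ball (z := x) (R := r / 2) hΩ
    (SubH.add hΩ (hu.sup (subH_const Ω c)) (subH_const Ω (-c)))
    (fun y _ => hpos _ (le_max_right _ _)) hvc
    (fun y hy => add_le_add_left (max_le (huφ y hy) (hlb y hy)) _) (hxB.trans hB)
  have h2 : (max (u x) (c : EReal) + ((-c : ℝ) : EReal)).toENNReal ≤ I / m := by
    rw [ENNReal.le_div_iff_mul_le (Or.inl hm0) (Or.inl hmtop)]
    exact h1.trans (lintegral_mono_set hxB)
  have h3 : max (u x) (c : EReal) + ((-c : ℝ) : EReal) ≤ (((I / m).toReal : ℝ) : EReal) := by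
    have := EReal.coe_ennreal_le_coe_ennreal_iff.2 h2
    rw [EReal.coe_toENNReal (hpos _ (le_max_right _ _))] at this
    rwa [EReal.coe_ennreal_toReal hK]
  have h4 := (add_le_add_left (le_max_left (u x) (c : EReal)) ((-c : ℝ) : EReal)).trans h3
  have h5 := hu.2.1 x hxΩ
  generalize u x = y at *
  induction y with
  | top => exact absurd rfl h5
  | bot => exact bot_le
  | coe y =>
    rw [← EReal.coe_add, EReal.coe_le_coe_iff] at h4
    rw [EReal.coe_le_coe_iff]
    linarith

end LocalBounds

section Exceptional

open MeasureTheory ENNReal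

variable {n : ℕ} {Ω : Set (Fin n → ℂ)} {φ : (Fin n → ℂ) → EReal}

theorem neg_Slam_nonpos {lam : ℝ} {z : Fin n → ℂ} : -Slam Ω φ lam z ≤ 0 := by
  rw [EReal.neg_le, neg_zero]
  exact Slam_nonneg

theorem subH_sum_neg_Slam (hΩ : IsOpen Ω) (lam : ℕ → ℝ) (N : ℕ) :
    SubH Ω fun z => ∑ j ∈ Finset.range N, -Slam Ω φ (lam j) z := by
  induction N with
  | zero => simpa using subH_const Ω 0
  | succ N ih =>
    simp only [Finset.sum_range_succ]
    exact SubH.add hΩ ih (subH_neg_Slam hΩ)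

/-- For tame `φ` the functions `S_λ φ` tend to zero outside a pluripolar set. -/
theorem Tame.exists_pluripolar (hΩ : IsOpen Ω) (hne : Ω.Nonempty) (htame : Tame Ω φ) :
    ∃ E, Pluripolar Ω E ∧ ∀ z ∈ Ω \ E, ∀ ε : ℝ, 0 < ε →
      ∃ lam : ℝ, 0 ≤ lam ∧ Slam Ω φ lam z < ε := by
  obtain ⟨z₁, hz₁⟩ := hne
  obtain ⟨R, hR, hB⟩ := Metric.isOpen_iff.1 hΩ z₁ hz₁
  have hchoice : ∀ j : ℕ, ∃ lam : ℝ, 0 ≤ lam ∧ ∃ ζ ∈ Metric.ball z₁ (R / 4),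
      Slam Ω φ lam ζ < (((2 : ℝ≥0∞)⁻¹ ^ j : ℝ≥0∞) : EReal) := by
    intro j
    have hlt : Sop Ω φ z₁ < (((2 : ℝ≥0∞)⁻¹ ^ j : ℝ≥0∞) : EReal) := by
      rw [htame z₁ hz₁, EReal.coe_ennreal_pos]
      exact ENNReal.pow_pos (by simp) j
    have hfreq := frequently_lt_of_liminf_lt (h := hlt)
    obtain ⟨ζ, hζ, hζB⟩ := (hfreq.and_eventually (mem_nhdsWithin_of_mem_nhds
      (Metric.ball_mem_nhds z₁ (by positivity : 0 < R / 4)))).exists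
    obtain ⟨lam, hlam⟩ := iInf_lt_iff.1 hζ
    obtain ⟨h0, hlt⟩ := iInf_lt_iff.1 hlam
    exact ⟨lam, h0, ζ, hζB, hlt⟩
  choose lam hlam0 ζ hζB hζ using hchoice
  have hsub : ∀ j, Metric.ball (ζ j) (R / 2) ⊆ Ω := fun j =>
    (Metric.ball_subset_ball' (by have := Metric.mem_ball.1 (hζB j); linarith)).trans hB
  have hsub' : ∀ j, Metric.ball z₁ (R / 4) ⊆ Metric.ball (ζ j) (R / 2) := fun j =>
    Metric.ball_subset_ball' (by have := Metric.mem_ball'.1 (hζB j); linarith)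
  have hS : ∀ j, SubH Ω fun z => -Slam Ω φ (lam j) z := fun j => subH_neg_Slam hΩ
  set G : ℕ → (Fin n → ℂ) → ℝ≥0∞ := fun j => extZero Ω (Slam Ω φ (lam j)) with hG
  have hGm : ∀ j, Measurable (G j) := fun j => measurable_extZero hΩ (lsc_of_neg (hS j))
  set m := volume (Metric.ball (0 : Fin n → ℂ) (R / 2)) with hm
  have hbound : ∀ j, ∫⁻ w in Metric.ball z₁ (R / 4), G j w ≤ (2 : ℝ≥0∞)⁻¹ ^ j * m := by
    intro j
    refine (lintegral_mono_set (hsub' j)).trans ((setLIntegral_ball_le hΩ (hS j)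
      (fun _ _ => Slam_nonneg) (hsub j)).trans ?_)
    gcongr
    exact (EReal.toENNReal_le_toENNReal (hζ j).le).trans_eq EReal.toENNReal_coe
  have htot : ∫⁻ w in Metric.ball z₁ (R / 4), ∑' j, G j w < ∞ := by
    rw [lintegral_tsum fun j => (hGm j).aemeasurable]
    refine (ENNReal.tsum_le_tsum hbound).trans_lt ?_
    rw [ENNReal.tsum_mul_right, ENNReal.tsum_geometric, ENNReal.one_sub_inv_two, inv_inv]
    exact ENNReal.mul_lt_top (by simp) measure_ball_lt_top
  have hae := (ae_lt_top (Measurable.tsum hGm) htot.ne).and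
    (ae_restrict_mem Metric.isOpen_ball.measurableSet)
  have : NeBot (ae (volume.restrict (Metric.ball z₁ (R / 4)))) := by
    rw [ae_neBot]
    simpa [Measure.restrict_eq_zero] using
      (Metric.measure_ball_pos (volume : Measure (Fin n → ℂ)) z₁
        (by positivity : 0 < R / 4)).ne'
  obtain ⟨z₀, hz₀, hz₀B⟩ := hae.exists
  have hz₀Ω : z₀ ∈ Ω := hB (Metric.ball_subset_ball (by linarith) hz₀B)
  set b : ℕ → (Fin n → ℂ) → EReal := fun N z =>
    ∑ j ∈ Finset.range N, -Slam Ω φ (lam j) z with hb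
  have hbsucc : ∀ N z, b (N + 1) z = b N z + -Slam Ω φ (lam N) z := fun N z =>
    Finset.sum_range_succ _ _
  have hanti : ∀ z, Antitone fun N => b N z := fun z => antitone_nat_of_succ_le fun N => by
    rw [hbsucc]
    calc b N z + -Slam Ω φ (lam N) z ≤ b N z + 0 := by
          gcongr
          exact neg_Slam_nonpos
      _ = b N z := add_zero _
  have hw : SubH Ω fun z => ⨅ N, b N z :=
    SubH.iInf_of_antitone (fun N => subH_sum_neg_Slam hΩ lam N) fun z _ => hanti z
  have hlow : ∀ N, -((∑ j ∈ Finset.range N, G j z₀ : ℝ≥0∞) : EReal) ≤ b N z₀ := by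
    intro N
    induction N with
    | zero => simp [hb]
    | succ N ih =>
      rw [hbsucc, Finset.sum_range_succ, EReal.coe_ennreal_add,
        EReal.neg_add (Or.inl (EReal.coe_ennreal_ne_bot _)) (Or.inr (EReal.coe_ennreal_ne_bot _)),
        sub_eq_add_neg]
      refine add_le_add ih ?_
      simp only [hG, extZero, indicator_of_mem hz₀Ω]
      rw [EReal.coe_toENNReal Slam_nonneg]
  have hw₀ : ⨅ N, b N z₀ ≠ ⊥ := by
    refine ne_bot_of_le_ne_bot (b := -((∑' j, G j z₀ : ℝ≥0∞) : EReal)) ?_ (le_iInf fun N => ?_)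
    · rw [Ne, EReal.neg_eq_bot_iff, EReal.coe_ennreal_eq_top_iff]
      exact hz₀.ne
    · refine le_trans ?_ (hlow N)
      rw [EReal.neg_le_neg_iff, EReal.coe_ennreal_le_coe_ennreal_iff]
      exact ENNReal.sum_le_tsum _
  refine ⟨{z ∈ Ω | ⨅ N, b N z = ⊥}, ⟨fun z hz => hz.1, _,
    isPSH_iff.2 ⟨hw, z₀, hz₀Ω, hw₀⟩, fun z hz => hz.2⟩, fun z hz ε hε => ?_⟩
  by_contra! hcon
  refine hz.2 ⟨hz.1, ?_⟩
  have hup : ∀ N : ℕ, b N z ≤ ((-(N * ε) : ℝ) : EReal) := by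
    intro N
    induction N with
    | zero => simp [hb]
    | succ N ih =>
      rw [hbsucc]
      have h1 : -Slam Ω φ (lam N) z ≤ ((-ε : ℝ) : EReal) := by
        rw [EReal.coe_neg, EReal.neg_le_neg_iff]
        exact hcon (lam N) (hlam0 N)
      refine (add_le_add ih h1).trans_eq ?_
      rw [← EReal.coe_add]
      congr 1
      push_cast
      ring
  rw [EReal.eq_bot_iff_forall_lt]
  intro y
  obtain ⟨N, hN⟩ := exists_nat_gt (-y / ε)
  refine ((iInf_le _ N).trans (hup N)).trans_lt (EReal.coe_lt_coe_iff.2 ?_)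
  rw [div_lt_iff₀ hε] at hN
  linarith

end Exceptional

section Envelope

variable {n : ℕ} {Ω : Set (Fin n → ℂ)} {φ : (Fin n → ℂ) → EReal}

/-- The supremum of the competitors for `Perron Ω φ` that are continuous up to the boundary. -/
def continuousPerron {n : ℕ} (Ω : Set (Fin n → ℂ)) (φ : (Fin n → ℂ) → EReal)
    (z : Fin n → ℂ) : EReal :=
  sSup { y | ∃ u, IsPSH Ω u ∧ ContinuousOn u (closure Ω) ∧
    (∀ ξ ∈ closure Ω, uscReg Ω u ξ ≤ lscReg Ω φ ξ) ∧ y = u z }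

theorem continuousPerron_le (z : Fin n → ℂ) : continuousPerron Ω φ z ≤ Perron Ω φ z := by
  refine sSup_le_sSup ?_
  rintro _ ⟨u, hu, -, hle, rfl⟩
  exact ⟨u, hu, hle, rfl⟩

theorem lowerSemicontinuousOn_continuousPerron :
    LowerSemicontinuousOn (continuousPerron Ω φ) Ω := by
  intro z hz y hy
  obtain ⟨_, ⟨u, hu, huc, hle, rfl⟩, hyu⟩ := lt_sSup_iff.1 hy
  have h := (huc.mono subset_closure z hz).eventually (eventually_gt_nhds hyu)
  filter_upwards [h] with x hx
  exact hx.trans_le (le_sSup ⟨u, hu, huc, hle, rfl⟩)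

theorem upperSemicontinuousOn_perron (hΩ : IsOpen Ω) (hΩc : IsConnected Ω) (hφ : IsPSupH Ω φ)
    {c : ℝ} (hlb : ∀ z ∈ Ω, (c : EReal) ≤ φ z)
    (hcont : ∀ ξ ∈ closure Ω, uscReg Ω φ ξ = lscReg Ω φ ξ) :
    UpperSemicontinuousOn (Perron Ω φ) Ω := by
  have hφc := continuousOn_of_uscReg_eq hcont
  set F : Set ((Fin n → ℂ) → EReal) := {u | IsPSH Ω u ∧ ∀ z ∈ Ω, u z ≤ φ z} with hF
  have hle : ∀ z, ∀ u ∈ F, u z ≤ Perron Ω φ z := fun z u hu =>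
    le_sSup ⟨u, hu.1, (uscReg_le_lscReg_iff hcont u).2 hu.2, rfl⟩
  have hge : ∀ z b, (∀ u ∈ F, u z ≤ b) → Perron Ω φ z ≤ b := by
    intro z b hb
    refine sSup_le ?_
    rintro _ ⟨u, hu, hu', rfl⟩
    exact hb u ⟨hu, (uscReg_le_lscReg_iff hcont u).1 hu'⟩
  have hsub : SubH Ω (uscReg Ω (Perron Ω φ)) := by
    refine subH_uscReg hΩ (F := F) (fun u hu => hu.1.subH) (fun z _ => hle z)
      (fun z _ => hge z) fun z hz => ?_
    obtain ⟨K, hK⟩ := exists_eventually_minorant_le hΩ hΩc.isPreconnected hφ hφc hlb hz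
    refine ne_top_of_le_ne_top (EReal.coe_ne_top K) (limsup_le_of_le (h := ?_))
    filter_upwards [hK.filter_mono nhdsWithin_le_nhds] with x hx
    exact hge x K fun u hu => hx u hu.1.subH hu.2
  have hleφ : ∀ z ∈ Ω, uscReg Ω (Perron Ω φ) z ≤ φ z := by
    intro z hz
    rw [← lscReg_eq_self hcont hz]
    exact (uscReg_le_lscReg_iff hcont _).2 (fun x hx => hge x _ fun u hu => hu.2 x hx) z
      (subset_closure hz)
  obtain ⟨z₀, hz₀⟩ := hΩc.nonempty
  have hconst : (fun _ => (c : EReal)) ∈ F :=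
    ⟨isPSH_iff.2 ⟨subH_const Ω c, z₀, hz₀, EReal.coe_ne_bot c⟩, hlb⟩
  have hmem : uscReg Ω (Perron Ω φ) ∈ F :=
    ⟨isPSH_iff.2 ⟨hsub, z₀, hz₀, ne_bot_of_le_ne_bot (EReal.coe_ne_bot c)
      ((hle z₀ _ hconst).trans (le_uscReg hz₀ _))⟩, hleφ⟩
  intro z hz y hy
  filter_upwards [hsub.1 z hz y ((hle z _ hmem).trans_lt hy), self_mem_nhdsWithin] with x hx hxΩ
  exact (le_uscReg hxΩ _).trans_lt hx

theorem perron_le_continuousPerron (i : Fin n) (hΩ : IsOpen Ω) (hΩb : Bornology.IsBounded Ω)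
    (hreg : BRegular Ω) (hφ : IsPSupH Ω φ) {c : ℝ} (hlb : ∀ z ∈ Ω, (c : EReal) ≤ φ z)
    (hcont : ∀ ξ ∈ closure Ω, uscReg Ω φ ξ = lscReg Ω φ ξ) {z : Fin n → ℂ} (hz : z ∈ Ω)
    (hS : ∀ ε : ℝ, 0 < ε → ∃ lam : ℝ, 0 ≤ lam ∧ Slam Ω φ lam z < ε) :
    Perron Ω φ z ≤ continuousPerron Ω φ z := by
  have hφc := continuousOn_of_uscReg_eq hcont
  refine sSup_le ?_
  rintro _ ⟨u, hu, hle, rfl⟩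
  rw [uscReg_le_lscReg_iff hcont] at hle
  refine EReal.le_of_forall_pos_le_add_coe fun ε hε => ?_
  obtain ⟨lam, -, hlam⟩ := hS ε hε
  obtain ⟨f, hfc, hfs, hf⟩ := exists_truncation hφ.subH hlb hcont lam
  obtain ⟨V, hVc, hV, hVf, hVmax⟩ := BRegular.exists_continuous_envelope i hΩ hΩb hreg hfc hfs
  have hVφ : ∀ x ∈ Ω, (V x : EReal) ≤ φ x := fun x hx =>
    (EReal.coe_le_coe_iff.2 (hVf x hx)).trans ((hf x hx).le.trans (min_le_left _ _))
  have hVW : (V z : EReal) ≤ continuousPerron Ω φ z :=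
    le_sSup ⟨_, hV, continuous_coe_real_ereal.comp_continuousOn hVc,
      (uscReg_le_lscReg_iff hcont _).2 hVφ, rfl⟩
  have huV : u z + -Slam Ω φ lam z ≤ V z :=
    hVmax _ (hu.subH.add hΩ (subH_neg_Slam hΩ)) (fun x hx => by
      rw [hf x hx]
      exact SubH.add_neg_Slam_le_min hφc hx (hle x hx)) z hz
  have hneg : ((-ε : ℝ) : EReal) ≤ -Slam Ω φ lam z := by
    rw [EReal.coe_neg]
    exact EReal.neg_le_neg_iff.2 hlam.le
  calc u z = u z + ((-ε : ℝ) : EReal) + ε := by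
        rw [add_assoc, ← EReal.coe_add, neg_add_cancel, EReal.coe_zero, add_zero]
    _ ≤ continuousPerron Ω φ z + ε := by
        gcongr
        exact (add_le_add_right hneg _).trans (huV.trans hVW)

end Envelope

/-- part of Theorem 4.4: let `Ω ⊆ ℂⁿ` be a bounded B-regular domain and
let `φ` be a lower bounded, tame, plurisuperharmonic function on `Ω` with `φ* = φ_*` on
`cl(Ω)`. Then the Perron–Bremermann envelope `Pφ` is continuous on `Ω` outside a pluripolar
set; more precisely, `Pφ` coincides outside a pluripolar set with the supremum of the
subfamily of competitors that are plurisubharmonic on `Ω` and continuous on `cl(Ω)`. -/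
theorem statement11 {n : ℕ} (Ω : Set (Fin n → ℂ))
    (hΩo : IsOpen Ω) (hΩc : IsConnected Ω) (hΩb : Bornology.IsBounded Ω)
    (hΩreg : BRegular Ω)
    (φ : (Fin n → ℂ) → EReal) (hφ : IsPSupH Ω φ)
    (hlb : ∃ C : ℝ, ∀ z ∈ Ω, (C : EReal) ≤ φ z)
    (htame : Tame Ω φ)
    (hcont : ∀ ξ ∈ closure Ω, uscReg Ω φ ξ = lscReg Ω φ ξ) :
    ∃ E : Set (Fin n → ℂ), Pluripolar Ω E ∧
      ContinuousOn (Perron Ω φ) (Ω \ E) ∧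
      ∀ z ∈ Ω \ E, Perron Ω φ z =
        sSup { y | ∃ u, IsPSH Ω u ∧ ContinuousOn u (closure Ω) ∧
          (∀ ξ ∈ closure Ω, uscReg Ω u ξ ≤ lscReg Ω φ ξ) ∧ y = u z } := by
  obtain ⟨c, hlb⟩ := hlb
  rcases n.eq_zero_or_pos with rfl | hn
  · have hdisc : ∀ (u : (Fin 0 → ℂ) → EReal) (A : Set (Fin 0 → ℂ)), ContinuousOn u A :=
      fun u A => continuous_of_discreteTopology.continuousOn
    exact ⟨∅, ⟨empty_subset _, _, hφ, by simp⟩, hdisc _ _, fun z _ => by simp [Perron, hdisc]⟩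
  · obtain ⟨E, hE, hS⟩ := Tame.exists_pluripolar hΩo hΩc.nonempty htame
    have heq : ∀ z ∈ Ω \ E, Perron Ω φ z = continuousPerron Ω φ z := fun z hz =>
      (perron_le_continuousPerron ⟨0, hn⟩ hΩo hΩb hΩreg hφ hlb hcont hz.1 (hS z hz)).antisymm
        (continuousPerron_le z)
    refine ⟨E, hE, ?_, heq⟩
    rw [continuousOn_iff_lower_upperSemicontinuousOn]
    refine ⟨fun z hz y hy => ?_,
      (upperSemicontinuousOn_perron hΩo hΩc hφ hlb hcont).mono sdiff_subset⟩
    replace hy : y < continuousPerron Ω φ z := heq z hz ▸ hy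
    filter_upwards [lowerSemicontinuousOn_continuousPerron.mono sdiff_subset z hz y hy] with x hx
    exact hx.trans_le (continuousPerron_le x)
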